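/- Let a > 0 and b, c ∈ ℝ, and let g(x) = a·x²/2 + b·x + c. Let t ≥ 2 be an integer. Then: (1) if 1/H_t < a < 1/H_{t−1} and t is odd, then v_-(g) = v_+(g) = 1/t (and if a > 1/H_1 = 1, then v_-(g) = v_+(g) = 1); (2) if 1/H_t < a < 1/H_{t−1} and t is even, then 1/(t+1) ≤ v_-(g) ≤ v_+(g) ≤ 1/(t−1); (3) if a = 1/H_t and t is odd, then 1/(t+2) ≤ v_-(g) ≤ v_+(g) ≤ 1/t; (4) if a = 1/H_t and t is even, then 1/(t+1) ≤ v_-(g) ≤ v_+(g) ≤ 1/(t−1). -/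

import Mathlib

/-- One grid peeling step: remove the extreme points of the convex hull. -/
noncomputable def peel (U : Set (ℝ × ℝ)) : Set (ℝ × ℝ) :=
  U \ Set.extremePoints ℝ (convexHull ℝ U)

/-- The lattice points on or above the graph of `g`. -/
def Ugrid (g : ℝ → ℝ) : Set (ℝ × ℝ) :=
  {p | (∃ i j : ℤ, p = ((i : ℝ), (j : ℝ))) ∧ g p.1 ≤ p.2}

/-- Lower average speed of the grid peeling process started on `{(x,y) ∈ ℤ² : y ≥ g x}`. -/
noncomputable def vLower (g : ℝ → ℝ) : ℝ :=
  Filter.liminf (fun m : ℕ =>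
    sSup {γ : ℝ | peel^[m] (Ugrid g) ⊆ Ugrid (fun x => g x + γ)} / m) Filter.atTop

/-- Upper average speed of the grid peeling process started on `{(x,y) ∈ ℤ² : y ≥ g x}`. -/
noncomputable def vUpper (g : ℝ → ℝ) : ℝ :=
  Filter.limsup (fun m : ℕ =>
    sInf {γ : ℝ | Ugrid (fun x => g x + γ) ⊆ peel^[m] (Ugrid g)} / m) Filter.atTop

/-- The horizontal period `H_t = Σ ⌊t/x⌋·x` over pairs `1 ≤ y ≤ x ≤ t` with `gcd(x,y) = 1`. -/
def Hper (t : ℕ) : ℕ :=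
  ∑ p ∈ (Finset.Icc 1 t ×ˢ Finset.Icc 1 t).filter
      (fun p => p.2 ≤ p.1 ∧ Nat.gcd p.1 p.2 = 1),
    (t / p.1) * p.1


structure GP where
  s : ℤ
  N : ℤ
  D : ℤ
  x : ℤ → ℤ
  y : ℤ → ℤ
  k : ℤ → ℤ
  L : ℤ → ℤ
  K : ℤ → ℤ
  hs : 1 ≤ s
  hN1 : 1 ≤ N
  hsN : s - 1 ≤ N
  hNs : N ≤ s
  hD : 0 < D
  hdvd : ∀ u : ℤ, 1 ≤ u → u < s → u ∣ D
  hx : ∀ n, 0 < x n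
  hxy : ∀ n, D * y n = n * x n
  hcop : ∀ n, IsCoprime (x n) (y n)
  hk0 : ∀ n, 0 ≤ k n
  hk1 : ∀ n, k n * x n ≤ N
  hk2 : ∀ n, N < k n * x n + x n
  hL : ∀ n, L (n + 1) = L n + k n * x n
  hK : ∀ n, K (n + 1) = K n - s * (y n * k n)

namespace GP

lemma sub_one_div (q n : ℤ) (hq : 0 < q) : (n - 1) / q = n / q - if q ∣ n then 1 else 0 := by
  split_ifs with h
  · obtain ⟨m, rfl⟩ := h
    rw [Int.mul_ediv_cancel_left _ hq.ne']
    have : q * m - 1 = (q - 1) + q * (m - 1) := by ring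
    rw [this, Int.add_mul_ediv_left _ _ hq.ne', Int.ediv_eq_zero_of_lt (by omega) (by omega)]; ring
  · have h1 := Int.emod_add_mul_ediv n q
    have h2 := Int.emod_nonneg n hq.ne'
    have h3 := Int.emod_lt_of_pos n hq
    have h4 : n % q ≠ 0 := fun h' => h (Int.dvd_of_emod_eq_zero h')
    have : n - 1 = (n % q - 1) + q * (n / q) := by linarith
    rw [this, Int.add_mul_ediv_left _ _ hq.ne', Int.ediv_eq_zero_of_lt (by omega) (by omega)]; ring

variable (P : GP)

def E (n u : ℤ) : ℤ := -(((1 - 2 * n) * u) / (2 * P.D))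
def eps (n u : ℤ) : ℤ := -((-(n * u)) / P.D)

lemma dvd_iff (n v q : ℤ) (hv : 0 < v) (h : P.D = v * q) : P.x n ∣ v ↔ q ∣ n := by
  have h1 := P.hxy n
  rw [h] at h1
  constructor
  · rintro ⟨m, hm⟩
    refine ⟨m * P.y n, ?_⟩
    have := (P.hx n).ne'
    apply mul_right_cancel₀ this
    rw [← h1, hm]; ring
  · rintro ⟨m, hm⟩
    have hq : q ≠ 0 := by rintro rfl; have := P.hD; simp [h] at this
    have : v * P.y n = m * P.x n := by
      apply mul_left_cancel₀ hq
      linear_combination h1 + P.x n * hm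
    exact (P.hcop n).dvd_of_dvd_mul_right ⟨m, by linarith⟩

lemma quot_pos (v q : ℤ) (hv : 0 < v) (h : P.D = v * q) : 0 < q := by
  have := P.hD
  rw [h] at this
  exact pos_of_mul_pos_right this hv.le

lemma term_minus (n u : ℤ) (h1 : -P.s < u) (h2 : u < P.s) :
    P.E n u = P.eps n u + if (u < 0 ∧ P.x n ∣ u) then 1 else 0 := by
  unfold E eps
  rcases lt_trichotomy u 0 with hu | hu | hu
  · obtain ⟨v, rfl⟩ : ∃ v, u = -v := ⟨-u, by ring⟩
    have hv : 0 < v := by omega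
    obtain ⟨q, hq⟩ := P.hdvd v (by omega) (by omega)
    have hq0 := P.quot_pos v q hv hq
    have e1 : ((1 - 2 * n) * -v) / (2 * P.D) = (n - 1) / q := by
      rw [hq, show (1 - 2 * n) * -v = v * (2 * n - 1) by ring, show 2 * (v * q) = v * (2 * q) by ring,
        Int.mul_ediv_mul_of_pos _ _ hv, ← Int.ediv_ediv_of_nonneg (by norm_num)]
      congr 1; omega
    have e2 : (-(n * -v)) / P.D = n / q := by
      rw [hq, show -(n * -v) = v * n by ring, Int.mul_ediv_mul_of_pos _ _ hv]
    rw [e1, e2, sub_one_div q n hq0]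
    have := P.dvd_iff n v q hv hq
    simp only [Int.dvd_neg, this, hu, true_and]
    ring
  · subst hu; simp
  · obtain ⟨q, hq⟩ := P.hdvd u (by omega) (by omega)
    have hq0 := P.quot_pos u q hu hq
    have e1 : ((1 - 2 * n) * u) / (2 * P.D) = (-n) / q := by
      rw [hq, show (1 - 2 * n) * u = u * (1 - 2 * n) by ring, show 2 * (u * q) = u * (2 * q) by ring,
        Int.mul_ediv_mul_of_pos _ _ hu, ← Int.ediv_ediv_of_nonneg (by norm_num)]
      congr 1; omega
    have e2 : (-(n * u)) / P.D = (-n) / q := by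
      rw [hq, show -(n * u) = u * -n by ring, Int.mul_ediv_mul_of_pos _ _ hu]
    rw [e1, e2]
    simp [not_lt.mpr hu.le]

lemma term_plus (n u : ℤ) (h1 : -P.s < u) (h2 : u < P.s) :
    P.E (n + 1) u = P.eps n u + if (0 < u ∧ P.x n ∣ u) then 1 else 0 := by
  unfold E eps
  rcases lt_trichotomy u 0 with hu | hu | hu
  · obtain ⟨v, rfl⟩ : ∃ v, u = -v := ⟨-u, by ring⟩
    have hv : 0 < v := by omega
    obtain ⟨q, hq⟩ := P.hdvd v (by omega) (by omega)
    have hq0 := P.quot_pos v q hv hq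
    have e1 : ((1 - 2 * (n + 1)) * -v) / (2 * P.D) = n / q := by
      rw [hq, show (1 - 2 * (n + 1)) * -v = v * (2 * n + 1) by ring,
        show 2 * (v * q) = v * (2 * q) by ring,
        Int.mul_ediv_mul_of_pos _ _ hv, ← Int.ediv_ediv_of_nonneg (by norm_num)]
      congr 1; omega
    have e2 : (-(n * -v)) / P.D = n / q := by
      rw [hq, show -(n * -v) = v * n by ring, Int.mul_ediv_mul_of_pos _ _ hv]
    rw [e1, e2]
    simp [hv.le]
  · subst hu; simp
  · obtain ⟨q, hq⟩ := P.hdvd u (by omega) (by omega)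
    have hq0 := P.quot_pos u q hu hq
    have e1 : ((1 - 2 * (n + 1)) * u) / (2 * P.D) = (-n - 1) / q := by
      rw [hq, show (1 - 2 * (n + 1)) * u = u * (-1 - 2 * n) by ring,
        show 2 * (u * q) = u * (2 * q) by ring,
        Int.mul_ediv_mul_of_pos _ _ hu, ← Int.ediv_ediv_of_nonneg (by norm_num)]
      congr 1; omega
    have e2 : (-(n * u)) / P.D = (-n) / q := by
      rw [hq, show -(n * u) = u * -n by ring, Int.mul_ediv_mul_of_pos _ _ hu]
    rw [e1, e2, sub_one_div q (-n) hq0]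
    have := P.dvd_iff n u q hu hq
    simp only [Int.dvd_neg, this, hu, true_and]
    ring

/-- counting multiples below -/
lemma count_low (x A X B : ℤ) (hx : 0 < x) (hA : A ≤ X) (hB : X < B) :
    (∑ Z ∈ Finset.Ico A B, if (Z - X < 0 ∧ x ∣ Z - X) then (1:ℤ) else 0) = (X - A) / x := by
  rw [Finset.sum_boole]
  have : (Finset.Ico A B).filter (fun Z => Z - X < 0 ∧ x ∣ Z - X)
      = (Finset.Ico A X).filter (fun Z => Z ≡ X [ZMOD x]) := by
    ext Z
    simp only [Finset.mem_filter, Finset.mem_Ico]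
    constructor
    · rintro ⟨⟨h1, h2⟩, h3, h4⟩
      exact ⟨⟨h1, by omega⟩, ((Int.modEq_iff_dvd).2 (by rw [← neg_sub]; exact (Int.dvd_neg).2 h4))⟩
    · rintro ⟨⟨h1, h2⟩, h3⟩
      exact ⟨⟨h1, by omega⟩, by omega, by rw [← neg_sub]; exact (Int.dvd_neg).2 (Int.modEq_iff_dvd.1 h3)⟩
  rw [this, Int.Ico_filter_modEq_card _ _ hx]
  have e : ⌈((A:ℚ) - X) / x⌉ = -((X - A) / x) := by
    have h := Rat.floor_intCast_div_natCast (X - A) x.toNat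
    rw [show ((x.toNat : ℕ) : ℤ) = x from Int.toNat_of_nonneg hx.le] at h
    have h2 : ((x.toNat : ℕ) : ℚ) = (x : ℚ) := by
      exact_mod_cast congrArg (Int.cast : ℤ → ℚ) (Int.toNat_of_nonneg hx.le)
    rw [h2] at h
    rw [← h, ← Int.ceil_neg]
    congr 1
    push_cast; ring
  push_cast at *
  rw [e]
  have : 0 ≤ (X - A) / x := Int.ediv_nonneg (by omega) hx.le
  simp [this]

lemma count_high (x A X B : ℤ) (hx : 0 < x) (hA : A ≤ X) (hB : X < B) :
    (∑ Z ∈ Finset.Ico A B, if (0 < Z - X ∧ x ∣ Z - X) then (1:ℤ) else 0) = (B - 1 - X) / x := by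
  rw [show B - 1 - X = (-X) - (1 - B) by ring,
    ← count_low x (1 - B) (-X) (1 - A) hx (by omega) (by omega)]
  refine Finset.sum_nbij' (fun Z => -Z) (fun Z => -Z) ?_ ?_ ?_ ?_ ?_
  · intro Z hZ; simp only [Finset.mem_Ico] at *; omega
  · intro Z hZ; simp only [Finset.mem_Ico] at *; omega
  · intro Z _; simp
  · intro Z _; simp
  · intro Z _
    have : (-Z - -X) = -(Z - X) := by ring
    rw [this]
    simp only [Int.dvd_neg, Left.neg_neg_iff]

noncomputable def ce (n X : ℤ) : ℤ := -P.K n - ∑ Z ∈ Finset.Ico (P.L n) (P.L n + P.s), P.E n (Z - X)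
noncomputable def sg (n X : ℤ) : ℤ := -P.K n - ∑ Z ∈ Finset.Ico (P.L n) (P.L n + P.s), P.eps n (Z - X)

lemma ce_minus (n X : ℤ) (h1 : P.L n ≤ X) (h2 : X < P.L n + P.s) :
    P.ce n X = P.sg n X - (X - P.L n) / P.x n := by
  unfold ce sg
  rw [← count_low (P.x n) (P.L n) X (P.L n + P.s) (P.hx n) h1 h2]
  rw [sub_sub, ← Finset.sum_add_distrib]
  congr 1
  apply Finset.sum_congr rfl
  intro Z hZ
  rw [Finset.mem_Ico] at hZ
  rw [P.term_minus n _ (by omega) (by omega)]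

lemma eps_shift (n u j : ℤ) : P.eps n (u + P.x n * j) = P.eps n u + P.y n * j := by
  unfold eps
  have : -(n * (u + P.x n * j)) = -(n * u) + P.D * (-(P.y n * j)) := by
    have := P.hxy n
    linear_combination j * this
  rw [this, Int.add_mul_ediv_left _ _ P.hD.ne']; ring

lemma sg_shift (n X j : ℤ) : P.sg n (X + P.x n * j) = P.sg n X + P.s * (P.y n * j) := by
  unfold sg
  have : ∀ Z ∈ Finset.Ico (P.L n) (P.L n + P.s), P.eps n (Z - (X + P.x n * j))
      = P.eps n (Z - X) - P.y n * j := by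
    intro Z _
    rw [show Z - (X + P.x n * j) = (Z - X) + P.x n * (-j) by ring, eps_shift]; ring
  rw [Finset.sum_congr rfl this, Finset.sum_sub_distrib]
  have hs := P.hs
  simp only [Finset.sum_const, Int.card_Ico, nsmul_eq_mul]
  have : (((P.L n + P.s - P.L n).toNat : ℕ) : ℤ) = P.s := by
    rw [Int.toNat_of_nonneg (by omega)]; ring
  rw [this]; ring

lemma ce_plus (n X : ℤ) (h1 : P.L (n+1) ≤ X) (h2 : X < P.L (n+1) + P.s) :
    P.ce (n+1) X = P.sg n X - (P.L (n+1) + P.s - 1 - X) / P.x n := by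
  rw [← count_high (P.x n) (P.L (n+1)) X (P.L (n+1) + P.s) (P.hx n) h1 h2]
  have e : P.sg n X = -P.K (n+1) - ∑ Z ∈ Finset.Ico (P.L (n+1)) (P.L (n+1) + P.s), P.eps n (Z - X) := by
    have h3 := P.sg_shift n (X - P.x n * P.k n) (P.k n)
    rw [sub_add_cancel] at h3
    rw [h3, P.hK n]
    unfold sg
    have : ∑ Z ∈ Finset.Ico (P.L (n+1)) (P.L (n+1) + P.s), P.eps n (Z - X)
        = ∑ Z ∈ Finset.Ico (P.L n) (P.L n + P.s), P.eps n (Z - (X - P.x n * P.k n)) := by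
      have hL := P.hL n
      refine Finset.sum_nbij' (fun Z => Z - P.k n * P.x n) (fun Z => Z + P.k n * P.x n) ?_ ?_ ?_ ?_ ?_
      · intro Z hZ; simp only [Finset.mem_Ico] at *; rw [hL] at hZ; constructor <;> linarith [hZ.1, hZ.2]
      · intro Z hZ; simp only [Finset.mem_Ico] at *; rw [hL]; constructor <;> linarith [hZ.1, hZ.2]
      · intro Z _; simp
      · intro Z _; simp
      · intro Z _; congr 1; ring
    rw [this]; ring
  rw [e]
  unfold ce
  rw [sub_sub (-P.K (n+1)), ← Finset.sum_add_distrib]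
  congr 1
  apply Finset.sum_congr rfl
  intro Z hZ
  rw [Finset.mem_Ico] at hZ
  rw [P.term_plus n _ (by omega) (by omega)]

end GP


namespace GP
variable (P : GP)

lemma L_mono_succ (n : ℤ) : P.L n ≤ P.L (n+1) := by
  rw [P.hL]; have := mul_nonneg (P.hk0 n) (P.hx n).le; omega

lemma L_succ_le (n : ℤ) : P.L (n+1) ≤ P.L n + P.s := by
  rw [P.hL]; have := P.hk1 n; have := P.hNs; omega

lemma L_mono : Monotone P.L := monotone_int_of_le_succ P.L_mono_succ

lemma x_of_dvd (m : ℤ) : P.x (P.D * m) = 1 := by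
  have h := P.hxy (P.D * m)
  have h2 : P.y (P.D * m) = P.x (P.D * m) * m := by
    apply mul_left_cancel₀ P.hD.ne'; rw [h]; ring
  have h3 := P.hcop (P.D * m)
  rw [h2] at h3
  have h4 : IsUnit (P.x (P.D * m)) := h3.isUnit_of_dvd' dvd_rfl (Dvd.intro _ rfl)
  have := P.hx (P.D * m)
  rcases Int.isUnit_iff.1 h4 with h5 | h5 <;> omega

lemma k_of_dvd (m : ℤ) : P.k (P.D * m) = P.N := by
  have h1 := P.hk1 (P.D * m)
  have h2 := P.hk2 (P.D * m)
  rw [P.x_of_dvd] at h1 h2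
  omega

lemma L_D_step (m : ℤ) : P.L (P.D * m) + 1 ≤ P.L (P.D * (m+1)) := by
  have h1 : P.L (P.D * m + 1) ≤ P.L (P.D * (m+1)) := P.L_mono (by have := P.hD; linarith)
  rw [P.hL, P.k_of_dvd, P.x_of_dvd] at h1
  have := P.hN1
  omega

lemma L_large (m : ℕ) : P.L 0 + m ≤ P.L (P.D * m) := by
  induction m with
  | zero => simp
  | succ m ih => have := P.L_D_step m; push_cast; omega

lemma L_small (m : ℕ) : P.L (P.D * (-m)) ≤ P.L 0 - m := by
  induction m with
  | zero => simp
  | succ m ih =>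
    have := P.L_D_step (-(m:ℤ) - 1)
    rw [show -(m:ℤ) - 1 + 1 = -m by ring] at this
    push_cast; rw [show -((m:ℤ)+1) = -(m:ℤ) - 1 by ring]; omega

lemma cover (X : ℤ) : ∃ n, P.L n ≤ X ∧ X < P.L n + P.s := by
  obtain ⟨n, hn, hmax⟩ := Int.exists_greatest_of_bdd (P := fun n => P.L n ≤ X) (by
    refine ⟨P.D * ((X - P.L 0).toNat + 1 : ℕ), fun z hz => ?_⟩
    by_contra hlt
    push Not at hlt
    have h1 := P.L_mono hlt.le
    have h2 := P.L_large ((X - P.L 0).toNat + 1)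
    push_cast at h1 h2
    have := Int.self_le_toNat (X - P.L 0)
    omega) (by
    refine ⟨P.D * (-((P.L 0 - X).toNat : ℕ)), ?_⟩
    have h2 := P.L_small ((P.L 0 - X).toNat)
    have := Int.self_le_toNat (P.L 0 - X)
    omega)
  refine ⟨n, hn, ?_⟩
  have := P.L_succ_le n
  by_contra h
  have := hmax (n+1) (by omega)
  omega

lemma k_bound1 (n d : ℤ) (h : d ≤ P.s - 1) : d / P.x n ≤ P.k n := by
  have h1 := P.hk2 n
  have h2 := P.hsN
  have : d / P.x n < P.k n + 1 := by
    apply Int.ediv_lt_of_lt_mul (P.hx n)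
    rw [add_mul, one_mul]; omega
  omega

lemma k_bound2 (n d : ℤ) (h : P.k n * P.x n ≤ d) : P.k n ≤ d / P.x n :=
  (Int.le_ediv_iff_mul_le (P.hx n)).2 h

lemma ce_step (n X : ℤ) (h1 : P.L (n+1) ≤ X) (h2 : X < P.L n + P.s) :
    P.ce n X = P.ce (n+1) X := by
  have hm := P.L_mono_succ n
  rw [P.ce_minus n X (by omega) h2, P.ce_plus n X h1 (by omega)]
  have hL := P.hL n
  have a1 := P.k_bound1 n (X - P.L n) (by omega)
  have a2 := P.k_bound2 n (X - P.L n) (by omega)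
  have a3 := P.k_bound1 n (P.L (n+1) + P.s - 1 - X) (by omega)
  have a4 := P.k_bound2 n (P.L (n+1) + P.s - 1 - X) (by omega)
  omega

lemma ce_le (n m X : ℤ) (h : n ≤ m) (h1 : P.L m ≤ X) (h2 : X < P.L n + P.s) :
    P.ce n X = P.ce m X := by
  revert h1
  induction m, h using Int.leInduction with
  | base => intro _; rfl
  | succ m hm ih =>
    intro h1
    have := P.L_mono_succ m
    have := P.L_mono hm
    rw [ih (by omega), P.ce_step m X h1 (by omega)]

noncomputable def c (X : ℤ) : ℤ := P.ce (P.cover X).choose X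

lemma c_eq (n X : ℤ) (h1 : P.L n ≤ X) (h2 : X < P.L n + P.s) : P.c X = P.ce n X := by
  have h := (P.cover X).choose_spec
  unfold c
  rcases le_total n (P.cover X).choose with hle | hle
  · exact (P.ce_le _ _ X hle h.1 h2).symm
  · exact P.ce_le _ _ X hle h1 h.2

lemma c_window (n X : ℤ) (h1 : P.L n ≤ X) (h2 : X < P.L (n+1) + P.s) :
    P.c X = P.sg n X - min ((X - P.L n) / P.x n) ((P.L (n+1) + P.s - 1 - X) / P.x n) := by
  have hL := P.hL n
  have hm := P.L_succ_le n
  by_cases h : X < P.L n + P.s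
  · rw [P.c_eq n X h1 h, P.ce_minus n X h1 h, min_eq_left]
    exact (P.k_bound1 n (X - P.L n) (by omega)).trans (P.k_bound2 n _ (by omega))
  · rw [P.c_eq (n+1) X (by omega) h2, P.ce_plus n X (by omega) h2, min_eq_right]
    exact (P.k_bound1 n _ (by omega)).trans (P.k_bound2 n _ (by omega))

lemma window_shift (n X : ℤ) (h1 : P.L n ≤ X) (h2 : X + P.x n < P.L (n+1) + P.s) :
    P.c (X + P.x n) ≤ P.c X + P.s * P.y n + 1 ∧ P.c X + P.s * P.y n - 1 ≤ P.c (X + P.x n) := by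
  have hx := P.hx n
  rw [P.c_window n X h1 (by omega), P.c_window n (X + P.x n) (by omega) h2]
  have e1 := P.sg_shift n X 1
  simp only [mul_one] at e1
  rw [e1]
  have e2 : (X + P.x n - P.L n) / P.x n = (X - P.L n) / P.x n + 1 := by
    rw [show X + P.x n - P.L n = (X - P.L n) + P.x n * 1 by ring, Int.add_mul_ediv_left _ _ hx.ne']
  have e3 : (P.L (n+1) + P.s - 1 - (X + P.x n)) / P.x n = (P.L (n+1) + P.s - 1 - X) / P.x n - 1 := by
    rw [show P.L (n+1) + P.s - 1 - (X + P.x n) = (P.L (n+1) + P.s - 1 - X) + P.x n * (-1) by ring, Int.add_mul_ediv_left _ _ hx.ne']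
    ring
  rw [e2, e3]
  generalize P.s * P.y n = A
  constructor <;> omega

lemma down_step (n X : ℤ) (h1 : P.L (n+1) ≤ X) (h2 : X < P.L (n+1) + P.s) :
    ∃ b : ℤ, 0 ≤ b ∧ P.L n ≤ X - P.x n * b ∧ X - P.x n * b < P.L n + P.s ∧
      P.c (X - P.x n * b) = P.c X - P.s * (P.y n * b) := by
  have hL := P.hL n
  have hx := P.hx n
  obtain ⟨ρ, hρ⟩ : ∃ ρ, ρ = (P.L (n+1) + P.s - 1 - X) / P.x n := ⟨_, rfl⟩
  obtain ⟨q, hq⟩ : ∃ q, q = (X - P.L n) / P.x n := ⟨_, rfl⟩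
  have a1 : ρ ≤ P.k n := hρ ▸ P.k_bound1 n _ (by omega)
  have a2 : P.k n ≤ q := hq ▸ P.k_bound2 n _ (by omega)
  have a3 : 0 ≤ ρ := hρ ▸ Int.ediv_nonneg (by omega) hx.le
  have b1 := Int.emod_add_mul_ediv (X - P.L n) (P.x n)
  have b2 := Int.emod_nonneg (X - P.L n) hx.ne'
  have b3 := Int.emod_lt_of_pos (X - P.L n) hx
  rw [← hq] at b1
  have b4 : P.x n * ρ ≤ P.L (n+1) + P.s - 1 - X := by
    rw [hρ]; exact Int.mul_ediv_self_le hx.ne'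
  have b5 : P.x n * P.k n ≤ P.x n * q := mul_le_mul_of_nonneg_left a2 hx.le
  have b6 : 0 ≤ P.x n * ρ := mul_nonneg hx.le a3
  have b7 : P.x n * (q - ρ) = P.x n * q - P.x n * ρ := by ring
  have b8 : P.x n * P.k n = P.k n * P.x n := by ring
  have g1 : P.L n ≤ X - P.x n * (q - ρ) := by rw [b7]; omega
  have g2 : X - P.x n * (q - ρ) < P.L n + P.s := by rw [b7]; omega
  refine ⟨q - ρ, by omega, g1, g2, ?_⟩
  rw [P.c_eq n _ g1 g2, P.ce_minus n _ g1 g2, P.c_eq (n+1) X h1 h2, P.ce_plus n X h1 h2]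
  have e1 := P.sg_shift n X (-(q - ρ))
  rw [mul_neg, ← sub_eq_add_neg] at e1
  rw [e1, ← hρ]
  have e2 : (X - P.x n * (q - ρ) - P.L n) / P.x n = ρ := by
    rw [show X - P.x n * (q - ρ) - P.L n = (X - P.L n) + P.x n * (ρ - q) by ring,
      Int.add_mul_ediv_left _ _ hx.ne', ← hq]; ring
  rw [e2]; ring

lemma up_step (n X : ℤ) (h1 : P.L n ≤ X) (h2 : X < P.L n + P.s) :
    ∃ b : ℤ, 0 ≤ b ∧ P.L (n+1) ≤ X + P.x n * b ∧ X + P.x n * b < P.L (n+1) + P.s ∧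
      P.c (X + P.x n * b) = P.c X + P.s * (P.y n * b) := by
  have hL := P.hL n
  have hx := P.hx n
  obtain ⟨q, hq⟩ : ∃ q, q = (P.L (n+1) + P.s - 1 - X) / P.x n := ⟨_, rfl⟩
  obtain ⟨ρ, hρ⟩ : ∃ ρ, ρ = (X - P.L n) / P.x n := ⟨_, rfl⟩
  have a1 : ρ ≤ P.k n := hρ ▸ P.k_bound1 n _ (by omega)
  have a2 : P.k n ≤ q := hq ▸ P.k_bound2 n _ (by omega)
  have a3 : 0 ≤ ρ := hρ ▸ Int.ediv_nonneg (by omega) hx.le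
  have b1 := Int.emod_add_mul_ediv (P.L (n+1) + P.s - 1 - X) (P.x n)
  have b2 := Int.emod_nonneg (P.L (n+1) + P.s - 1 - X) hx.ne'
  have b3 := Int.emod_lt_of_pos (P.L (n+1) + P.s - 1 - X) hx
  rw [← hq] at b1
  have b4 : P.x n * ρ ≤ X - P.L n := by
    rw [hρ]; exact Int.mul_ediv_self_le hx.ne'
  have b5 : P.x n * P.k n ≤ P.x n * q := mul_le_mul_of_nonneg_left a2 hx.le
  have b6 : 0 ≤ P.x n * ρ := mul_nonneg hx.le a3
  have b7 : P.x n * (q - ρ) = P.x n * q - P.x n * ρ := by ring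
  have b8 : P.x n * P.k n = P.k n * P.x n := by ring
  have g1 : P.L (n+1) ≤ X + P.x n * (q - ρ) := by rw [b7]; omega
  have g2 : X + P.x n * (q - ρ) < P.L (n+1) + P.s := by rw [b7]; omega
  refine ⟨q - ρ, by omega, g1, g2, ?_⟩
  rw [P.c_eq (n+1) _ g1 g2, P.ce_plus n _ g1 g2, P.c_eq n X h1 h2, P.ce_minus n X h1 h2]
  rw [P.sg_shift n X (q - ρ), ← hρ]
  have e2 : (P.L (n+1) + P.s - 1 - (X + P.x n * (q - ρ))) / P.x n = ρ := by
    rw [show P.L (n+1) + P.s - 1 - (X + P.x n * (q - ρ)) = (P.L (n+1) + P.s - 1 - X) + P.x n * (ρ - q) by ring,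
      Int.add_mul_ediv_left _ _ hx.ne', ← hq]; ring
  rw [e2]; ring

end GP


namespace GP
variable (P : GP)

lemma E_le_iff (n u Y : ℤ) : P.E n u ≤ Y ↔ (2 * n - 1) * u ≤ 2 * P.D * Y := by
  unfold E
  have hD := P.hD
  rw [neg_le, Int.le_ediv_iff_mul_le (by omega)]
  constructor <;> intro h <;> nlinarith

lemma lt_E_iff (n u Y : ℤ) : Y < P.E n u ↔ 2 * P.D * Y < (2 * n - 1) * u := by
  rw [← not_le, E_le_iff, not_le]

lemma E_zero (n : ℤ) : P.E n 0 = 0 := by simp [E]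

lemma E_self (n u : ℤ) : (2 * n - 1) * u ≤ 2 * P.D * P.E n u := (P.E_le_iff n u _).1 le_rfl

lemma ce_diff (i X X' w : ℤ) : P.ce i X' - P.ce i X - P.s * w =
    ∑ Z ∈ Finset.Ico (P.L i) (P.L i + P.s), (P.E i (Z - X) - P.E i (Z - X') - w) := by
  unfold ce
  rw [Finset.sum_sub_distrib, Finset.sum_sub_distrib]
  have hs := P.hs
  simp only [Finset.sum_const, Int.card_Ico, nsmul_eq_mul]
  have : (((P.L i + P.s - P.L i).toNat : ℕ) : ℤ) = P.s := by
    rw [Int.toNat_of_nonneg (by omega)]; ring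
  rw [this]; ring

/-- inside a strip : lower phi gives larger c -/
lemma strip_le (i X X' w : ℤ)
    (h : 2 * P.D * w ≤ (2 * i - 1) * (X' - X)) : P.ce i X + P.s * w ≤ P.ce i X' := by
  have := P.ce_diff i X X' w
  have h2 : 0 ≤ ∑ Z ∈ Finset.Ico (P.L i) (P.L i + P.s), (P.E i (Z - X) - P.E i (Z - X') - w) := by
    apply Finset.sum_nonneg
    intro Z _
    have : P.E i (Z - X') ≤ P.E i (Z - X) - w := by
      rw [E_le_iff]
      have := P.E_self i (Z - X)
      nlinarith
    omega
  omega

lemma strip_lt (i X X' w : ℤ) (h1 : P.L i ≤ X') (h2 : X' < P.L i + P.s)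
    (h : 2 * P.D * w < (2 * i - 1) * (X' - X)) : P.ce i X + P.s * w + 1 ≤ P.ce i X' := by
  have := P.ce_diff i X X' w
  have h2 : 0 < ∑ Z ∈ Finset.Ico (P.L i) (P.L i + P.s), (P.E i (Z - X) - P.E i (Z - X') - w) := by
    apply Finset.sum_pos'
    · intro Z _
      have : P.E i (Z - X') ≤ P.E i (Z - X) - w := by
        rw [E_le_iff]
        have := P.E_self i (Z - X)
        nlinarith
      omega
    · refine ⟨X', Finset.mem_Ico.2 ⟨h1, h2⟩, ?_⟩
      rw [sub_self, E_zero]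
      have := (P.lt_E_iff i (X' - X) w).2 h
      omega
  omega

lemma no_tie (i d w : ℤ) (h1 : -P.s < d) (h2 : d < P.s) (h0 : d ≠ 0) :
    2 * P.D * w ≠ (2 * i - 1) * d := by
  intro h
  obtain ⟨q, hq⟩ : d ∣ P.D := by
    rcases lt_or_gt_of_ne h0 with h | h
    · have := P.hdvd (-d) (by omega) (by omega)
      exact (Int.neg_dvd).1 this
    · exact P.hdvd d (by omega) (by omega)
  rw [hq] at h
  have : 2 * (q * w) = 2 * i - 1 := by
    apply mul_left_cancel₀ h0
    linarith
  omega

lemma A_base (i X0 X Y : ℤ) (h1 : P.L i ≤ X0) (h2 : X0 < P.L i + P.s)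
    (h3 : P.L i ≤ X) (h4 : X < P.L i + P.s) (hf : P.c X - P.c X0 ≤ P.s * Y)
    (hne : ¬ (X = X0 ∧ Y = 0)) : (2 * i - 1) * (X - X0) < 2 * P.D * Y := by
  rw [P.c_eq i X h3 h4, P.c_eq i X0 h1 h2] at hf
  by_contra hcon
  push Not at hcon
  rcases hcon.lt_or_eq with h | h
  · have := P.strip_lt i X0 X Y h3 h4 h
    omega
  · by_cases h0 : X = X0
    · subst h0
      simp at h
      rcases h with h | h
      · have := P.hD; omega
      · exact hne ⟨rfl, h⟩
    · exact P.no_tie i (X - X0) Y (by omega) (by omega) (by omega) h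

lemma phi_w (i n : ℤ) : 2 * P.D * P.y n - (2 * i - 1) * P.x n = (2 * n - 2 * i + 1) * P.x n := by
  have := P.hxy n
  linear_combination 2 * this

lemma A_up (i X0 : ℤ) (h1 : P.L i ≤ X0) (h2 : X0 < P.L i + P.s) (j : ℤ) (hj : i ≤ j) :
    ∀ X Y : ℤ, P.L j ≤ X → X < P.L j + P.s → P.c X - P.c X0 ≤ P.s * Y →
    ¬ (X = X0 ∧ Y = 0) → (2 * i - 1) * (X - X0) < 2 * P.D * Y := by
  induction j, hj using Int.leInduction with
  | base => intro X Y h3 h4; exact P.A_base i X0 X Y h1 h2 h3 h4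
  | succ j hj ih =>
    intro X Y h3 h4 hf hne
    obtain ⟨b, hb0, hb1, hb2, hb3⟩ := P.down_step j X h3 h4
    have hphi := P.phi_w i j
    have hpos : 0 < (2 * j - 2 * i + 1) * P.x j := mul_pos (by omega) (P.hx j)
    by_cases he : X - P.x j * b = X0 ∧ Y - P.y j * b = 0
    · obtain ⟨e1, e2⟩ := he
      have hb : 0 < b := by
        rcases hb0.lt_or_eq with h | h
        · exact h
        · subst h; simp at e1 e2; exact absurd ⟨e1, e2⟩ hne
      have e3 : X - X0 = P.x j * b := by linarith
      have e4 : Y = P.y j * b := by linarith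
      rw [e3, e4]
      nlinarith
    · have := ih (X - P.x j * b) (Y - P.y j * b) hb1 hb2 (by rw [hb3]; linarith) he
      nlinarith [mul_nonneg hb0 hpos.le]

lemma A_down (i X0 : ℤ) (h1 : P.L i ≤ X0) (h2 : X0 < P.L i + P.s) (r : ℕ) :
    ∀ X Y : ℤ, P.L (i - r) ≤ X → X < P.L (i - r) + P.s → P.c X - P.c X0 ≤ P.s * Y →
    ¬ (X = X0 ∧ Y = 0) → (2 * i - 1) * (X - X0) < 2 * P.D * Y := by
  induction r with
  | zero => intro X Y h3 h4; simp at h3 h4; exact P.A_base i X0 X Y h1 h2 h3 h4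
  | succ r ih =>
    intro X Y h3 h4 hf hne
    obtain ⟨j, hj⟩ : ∃ j : ℤ, j = i - (r + 1 : ℕ) := ⟨_, rfl⟩
    rw [← hj] at h3 h4
    obtain ⟨b, hb0, hb1, hb2, hb3⟩ := P.up_step j X h3 h4
    have hj' : i - (r : ℤ) = j + 1 := by push_cast at hj; omega
    rw [hj'] at ih
    have hphi := P.phi_w i j
    have hpos : 0 < -((2 * j - 2 * i + 1) * P.x j) := by
      rw [← neg_mul]
      exact mul_pos (by omega) (P.hx j)
    by_cases he : X + P.x j * b = X0 ∧ Y + P.y j * b = 0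
    · obtain ⟨e1, e2⟩ := he
      have hb : 0 < b := by
        rcases hb0.lt_or_eq with h | h
        · exact h
        · subst h; simp at e1 e2; exact absurd ⟨e1, e2⟩ hne
      have e3 : X - X0 = -(P.x j * b) := by linarith
      have e4 : Y = -(P.y j * b) := by linarith
      rw [e3, e4]
      nlinarith
    · have := ih (X + P.x j * b) (Y + P.y j * b) hb1 hb2 (by rw [hb3]; linarith) he
      nlinarith [mul_nonneg hb0 hpos.le]

theorem Astar (X0 : ℤ) : ∃ i : ℤ, ∀ X Y : ℤ, P.c X - P.c X0 ≤ P.s * Y →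
    ¬ (X = X0 ∧ Y = 0) → (2 * i - 1) * (X - X0) < 2 * P.D * Y := by
  obtain ⟨i, h1, h2⟩ := P.cover X0
  refine ⟨i, fun X Y => ?_⟩
  obtain ⟨j, h3, h4⟩ := P.cover X
  rcases le_total i j with h | h
  · exact P.A_up i X0 h1 h2 j h X Y h3 h4
  · obtain ⟨r, hr⟩ := Int.eq_ofNat_of_zero_le (sub_nonneg.2 h)
    have e : j = i - (r : ℤ) := by omega
    rw [e] at h3 h4
    exact P.A_down i X0 h1 h2 r X Y h3 h4

end GP


namespace GP
variable (P : GP)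

lemma k_pos_iff (n : ℤ) : 1 ≤ P.k n ↔ P.x n ≤ P.N := by
  have h1 := P.hk1 n
  have h2 := P.hk2 n
  have h0 := P.hk0 n
  have hx := P.hx n
  constructor
  · intro h; nlinarith
  · intro h; by_contra hc
    have : P.k n = 0 := by omega
    rw [this] at h2; omega

/-- any fraction v/u with small denominator has an index -/
lemma index_of (hN : P.N = P.s - 1) (u v : ℤ) (hu : 1 ≤ u) (hu2 : u ≤ P.N) :
    ∃ m, P.D * v = m * u ∧ 1 ≤ P.k m := by
  obtain ⟨q, hq⟩ := P.hdvd u hu (by omega)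
  refine ⟨q * v, by rw [hq]; ring, ?_⟩
  rw [k_pos_iff]
  have h1 := P.hxy (q * v)
  have h2 : u * P.y (q * v) = v * P.x (q * v) := by
    apply mul_left_cancel₀ (P.quot_pos u q (by omega) hq).ne'
    rw [hq] at h1; linarith
  have h3 : P.x (q * v) ∣ u := (P.hcop (q * v)).dvd_of_dvd_mul_right ⟨v, by linarith⟩
  exact (Int.le_of_dvd (by omega) h3).trans hu2

lemma det_pos (n m : ℤ) (h : n < m) : 0 < P.x n * P.y m - P.y n * P.x m := by
  have h1 := P.hxy n
  have h2 := P.hxy m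
  have hD := P.hD
  have : P.D * (P.x n * P.y m - P.y n * P.x m) = (m - n) * (P.x n * P.x m) := by
    linear_combination P.x n * h2 - P.x m * h1
  have h3 : 0 < P.D * (P.x n * P.y m - P.y n * P.x m) := by
    rw [this]; exact mul_pos (by omega) (mul_pos (P.hx n) (P.hx m))
  exact pos_of_mul_pos_right h3 hD.le

lemma farey (hN : P.N = P.s - 1) (n n2 : ℤ) (hn : n < n2) (hk : 1 ≤ P.k n) (hk2 : 1 ≤ P.k n2)
    (hgap : ∀ m, n < m → 1 ≤ P.k m → n2 ≤ m) :
    P.x n * P.y n2 - P.y n * P.x n2 = 1 ∧ P.s ≤ P.x n + P.x n2 := by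
  have hD := P.hD
  have hx := P.hx n
  have hx2 := P.hx n2
  have hxN := (P.k_pos_iff n).1 hk
  have hxN2 := (P.k_pos_iff n2).1 hk2
  have e1 := P.hxy n
  have e2 := P.hxy n2
  have hd := P.det_pos n n2 hn
  constructor
  · -- choose neighbour
    obtain ⟨a, b, hab⟩ := P.hcop n
    -- x * a + y * b = 1 : x' = -b, y' = a
    obtain ⟨r, hr⟩ : ∃ r : ℤ, r = (P.N + b) / P.x n := ⟨_, rfl⟩
    have r1 := Int.emod_add_mul_ediv (P.N + b) (P.x n)
    have r2 := Int.emod_nonneg (P.N + b) hx.ne'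
    have r3 := Int.emod_lt_of_pos (P.N + b) hx
    rw [← hr] at r1
    obtain ⟨x', hx'⟩ : ∃ x', x' = -b + P.x n * r := ⟨_, rfl⟩
    obtain ⟨y', hy'⟩ : ∃ y', y' = a + P.y n * r := ⟨_, rfl⟩
    have d1 : P.x n * y' - P.y n * x' = 1 := by
      rw [hx', hy']; linear_combination hab
    have x1 : P.N < x' + P.x n := by omega
    have x2 : x' ≤ P.N := by omega
    obtain ⟨m, hm, hkm⟩ := P.index_of hN x' y' (by omega) x2
    have x0 : 0 < x' := by omega
    have hmn : n < m := by
      have : (m - n) * (P.x n * x') = P.D := by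
        linear_combination P.D * d1 + x' * e1 - P.x n * hm
      by_contra hc
      have : (m - n) * (P.x n * x') ≤ 0 :=
        mul_nonpos_of_nonpos_of_nonneg (by omega) (mul_pos hx x0).le
      omega
    have hm2 := hgap m hmn hkm
    have d2 : 0 ≤ P.x n2 * y' - P.y n2 * x' := by
      have h3 : P.D * (P.x n2 * y' - P.y n2 * x') = (m - n2) * (P.x n2 * x') := by
        linear_combination P.x n2 * hm - x' * e2
      have h4 : 0 ≤ P.D * (P.x n2 * y' - P.y n2 * x') := by
        rw [h3]; exact mul_nonneg (by omega) (mul_pos hx2 x0).le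
      exact nonneg_of_mul_nonneg_right h4 hD
    have id1 : P.x n2 = P.x n * (P.x n2 * y' - P.y n2 * x') + x' * (P.x n * P.y n2 - P.y n * P.x n2) := by
      linear_combination (-P.x n2) * d1
    have d3 : P.x n2 * y' - P.y n2 * x' = 0 := by
      by_contra hc
      have h5 : 1 ≤ P.x n2 * y' - P.y n2 * x' := by omega
      have h6 : P.x n * 1 ≤ P.x n * (P.x n2 * y' - P.y n2 * x') := mul_le_mul_of_nonneg_left h5 hx.le
      have h7 : x' * 1 ≤ x' * (P.x n * P.y n2 - P.y n * P.x n2) := mul_le_mul_of_nonneg_left hd x0.le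
      omega
    have h8 : P.x n2 ∣ x' := (P.hcop n2).dvd_of_dvd_mul_right ⟨y', by linarith⟩
    have h9 := Int.le_of_dvd x0 h8
    rw [d3] at id1
    by_contra hc
    have h10 : 2 ≤ P.x n * P.y n2 - P.y n * P.x n2 := by omega
    nlinarith
  · by_contra hc
    push Not at hc
    obtain ⟨m, hm, hkm⟩ := P.index_of hN (P.x n + P.x n2) (P.y n + P.y n2) (by omega) (by omega)
    have f1 : (m - n) * (P.x n + P.x n2) = (n2 - n) * P.x n2 := by
      linear_combination e1 + e2 - hm
    have f2 : (n2 - m) * (P.x n + P.x n2) = (n2 - n) * P.x n := by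
      linear_combination hm - e1 - e2
    have g1 : n < m := by
      by_contra h
      have h3 : 0 < (n2 - n) * P.x n2 := mul_pos (by omega) hx2
      have h4 : (m - n) * (P.x n + P.x n2) ≤ 0 := mul_nonpos_of_nonpos_of_nonneg (by omega) (by omega)
      omega
    have g2 : m < n2 := by
      by_contra h
      have h3 : 0 < (n2 - n) * P.x n := mul_pos (by omega) hx
      have h4 : (n2 - m) * (P.x n + P.x n2) ≤ 0 := mul_nonpos_of_nonpos_of_nonneg (by omega) (by omega)
      omega
    have := hgap m g1 hkm
    omega

lemma L_const (a b : ℤ) (hab : a ≤ b) (h : ∀ m, a ≤ m → m < b → ¬ 1 ≤ P.k m) : P.L a = P.L b := by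
  revert h
  induction b, hab using Int.leInduction with
  | base => intro _; rfl
  | succ b hb ih =>
    intro h
    rw [P.hL b, ih (fun m h1 h2 => h m h1 (by omega))]
    have h1 := h b hb (by omega)
    have h0 := P.hk0 b
    have : P.k b = 0 := by omega
    rw [this]; ring

lemma exists_lower (i : ℤ) : ∃ n, n < i ∧ 1 ≤ P.k n ∧ ∀ m, n < m → m < i → ¬ 1 ≤ P.k m := by
  have hD := P.hD
  obtain ⟨n, ⟨hn1, hn2⟩, hmax⟩ := Int.exists_greatest_of_bdd (P := fun n => n < i ∧ 1 ≤ P.k n)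
    ⟨i, fun z hz => hz.1.le⟩ ⟨P.D * (-(|i| + 1)), by
      constructor
      · have := neg_abs_le i
        nlinarith [abs_nonneg i]
      · rw [P.k_of_dvd]; exact P.hN1⟩
  refine ⟨n, hn1, hn2, fun m h1 h2 h3 => ?_⟩
  have := hmax m ⟨h2, h3⟩
  omega

lemma exists_upper (i : ℤ) : ∃ n, i ≤ n ∧ 1 ≤ P.k n ∧ ∀ m, i ≤ m → m < n → ¬ 1 ≤ P.k m := by
  have hD := P.hD
  obtain ⟨n, ⟨hn1, hn2⟩, hmin⟩ := Int.exists_least_of_bdd (P := fun n => i ≤ n ∧ 1 ≤ P.k n)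
    ⟨i, fun z hz => hz.1⟩ ⟨P.D * (|i| + 1), by
      constructor
      · have := le_abs_self i
        nlinarith [abs_nonneg i]
      · rw [P.k_of_dvd]; exact P.hN1⟩
  refine ⟨n, hn1, hn2, fun m h1 h2 h3 => ?_⟩
  have := hmin m ⟨h1, h3⟩
  omega

/-- the gap lemma (pure arithmetic) -/
lemma gap_unique (i n n2 X Lf d j : ℤ) (hn : n < i) (hi : i ≤ n2)
    (hdet : P.x n * P.y n2 - P.y n * P.x n2 = 1) (hsum : P.s ≤ P.x n + P.x n2)
    (hX1 : Lf ≤ X) (hX2 : X < Lf + P.s) (hd1 : Lf ≤ X + d) (hd2 : X + d < Lf + P.s)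
    (hc1 : Lf + P.s ≤ X + P.x n) (hc2 : X - P.x n2 < Lf)
    (hphi1 : 2 * P.D * (P.y n - P.y n2) - (2 * i - 1) * (P.x n - P.x n2) ≤ 2 * P.D * j - (2 * i - 1) * d)
    (hphi2 : 2 * P.D * j < (2 * i - 1) * d) :
    d = P.x n - P.x n2 ∧ j = P.y n - P.y n2 := by
  have hx := P.hx n
  have hx2 := P.hx n2
  have p1 := P.phi_w i n
  have p2 := P.phi_w i n2
  obtain ⟨A, hA⟩ : ∃ A, A = (2 * n2 - 2 * i + 1) * P.x n2 := ⟨_, rfl⟩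
  obtain ⟨B, hB⟩ : ∃ B, B = -((2 * n - 2 * i + 1) * P.x n) := ⟨_, rfl⟩
  have hA0 : 0 < A := by rw [hA]; exact mul_pos (by omega) hx2
  have hB0 : 0 < B := by rw [hB, ← neg_mul]; exact mul_pos (by omega) hx
  obtain ⟨α, hα⟩ : ∃ α, α = P.x n * j - P.y n * d := ⟨_, rfl⟩
  obtain ⟨β, hβ⟩ : ∃ β, β = P.x n2 * j - P.y n2 * d := ⟨_, rfl⟩
  have ed : d = α * P.x n2 - β * P.x n := by
    rw [hα, hβ]; linear_combination (-d) * hdet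
  have ej : j = α * P.y n2 - β * P.y n := by
    rw [hα, hβ]; linear_combination (-j) * hdet
  have ephi : 2 * P.D * j - (2 * i - 1) * d = α * A + β * B := by
    rw [ed, ej, hA, hB, ← p1, ← p2]; ring
  have ephi2 : 2 * P.D * (P.y n - P.y n2) - (2 * i - 1) * (P.x n - P.x n2) = - A - B := by
    rw [hA, hB, ← p1, ← p2]; ring
  rw [ephi, ephi2] at hphi1
  have hphi3 : α * A + β * B < 0 := by omega
  have hα0 : α ≤ 0 := by
    by_contra h
    push Not at h
    rcases le_or_gt 0 β with hb | hb
    · have h3 := mul_pos h hA0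
      have h4 := mul_nonneg hb hB0.le
      omega
    · have h3 : 1 * P.x n2 ≤ α * P.x n2 := mul_le_mul_of_nonneg_right (by omega) hx2.le
      have h4 : β * P.x n ≤ (-1) * P.x n := mul_le_mul_of_nonneg_right (by omega) hx.le
      omega
  have hβ0 : β ≤ 0 := by
    by_contra h
    push Not at h
    rcases hα0.lt_or_eq with hb | hb
    · have h3 : α * P.x n2 ≤ (-1) * P.x n2 := mul_le_mul_of_nonneg_right (by omega) hx2.le
      have h4 : 1 * P.x n ≤ β * P.x n := mul_le_mul_of_nonneg_right (by omega) hx.le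
      omega
    · rw [hb] at hphi3
      have h4 := mul_pos h hB0
      omega
  have hα1 : α ≤ -1 := by
    by_contra h
    have h0 : α = 0 := by omega
    rw [h0] at ed hphi3
    have h1 : β ≤ -1 := by
      by_contra h; have : β = 0 := by omega
      rw [this] at hphi3; simp at hphi3
    have h4 : β * P.x n ≤ (-1) * P.x n := mul_le_mul_of_nonneg_right h1 hx.le
    omega
  have hβ1 : β ≤ -1 := by
    by_contra h
    have h0 : β = 0 := by omega
    rw [h0] at ed
    have h3 : α * P.x n2 ≤ (-1) * P.x n2 := mul_le_mul_of_nonneg_right hα1 hx2.le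
    omega
  have hα2 : α = -1 := by
    by_contra h
    have h3 : α * A ≤ (-2) * A := mul_le_mul_of_nonneg_right (by omega) hA0.le
    have h4 : β * B ≤ (-1) * B := mul_le_mul_of_nonneg_right hβ1 hB0.le
    omega
  have hβ2 : β = -1 := by
    by_contra h
    have h3 : α * A ≤ (-1) * A := mul_le_mul_of_nonneg_right hα1 hA0.le
    have h4 : β * B ≤ (-2) * B := mul_le_mul_of_nonneg_right (by omega) hB0.le
    omega
  rw [hα2, hβ2] at ed ej
  constructor
  · rw [ed]; ring
  · rw [ej]; ring

theorem Bstar (hN : P.N = P.s - 1) (X : ℤ) : ∃ u w : ℤ, ¬ (u = 0 ∧ w = 0) ∧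
    P.c (X + u) ≤ P.c X + P.s * w + 1 ∧ P.c (X - u) ≤ P.c X - P.s * w + 1 := by
  obtain ⟨i, hX1, hX2⟩ := P.cover X
  obtain ⟨n, hni, hkn, hngap⟩ := P.exists_lower i
  obtain ⟨n2, hni2, hkn2, hngap2⟩ := P.exists_upper i
  have hx := P.hx n
  have hx2 := P.hx n2
  have hxN := (P.k_pos_iff n).1 hkn
  have hxN2 := (P.k_pos_iff n2).1 hkn2
  have L1 : P.L (n+1) = P.L i := P.L_const (n+1) i (by omega) (fun m h1 h2 => hngap m (by omega) h2)
  have L2 : P.L i = P.L n2 := P.L_const i n2 hni2 hngap2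
  have L3 : P.L n + P.x n ≤ P.L i := by
    rw [← L1, P.hL]; nlinarith
  have L4 : P.L i + P.x n2 ≤ P.L (n2+1) := by
    rw [P.hL, L2]; nlinarith
  by_cases c1 : X + P.x n < P.L i + P.s
  · refine ⟨P.x n, P.y n, by omega, (P.window_shift n X (by omega) (by omega)).1, ?_⟩
    have := (P.window_shift n (X - P.x n) (by omega) (by omega)).2
    rw [sub_add_cancel] at this
    omega
  by_cases c2 : P.L i ≤ X - P.x n2
  · refine ⟨P.x n2, P.y n2, by omega, (P.window_shift n2 X (by omega) (by omega)).1, ?_⟩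
    have := (P.window_shift n2 (X - P.x n2) (by omega) (by omega)).2
    rw [sub_add_cancel] at this
    omega
  obtain ⟨hdet, hsum⟩ := P.farey hN n n2 (by omega) hkn hkn2 (by
    intro m h1 h2
    by_contra h3
    rcases lt_or_ge m i with h | h
    · exact hngap m h1 h h2
    · exact hngap2 m h (by omega) h2)
  have p1 := P.phi_w i n
  have p2 := P.phi_w i n2
  have q1 : (2 * n - 2 * i + 1) * P.x n < 0 := mul_neg_of_neg_of_pos (by omega) hx
  have q2 : 0 < (2 * n2 - 2 * i + 1) * P.x n2 := mul_pos (by omega) hx2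
  refine ⟨P.x n - P.x n2, P.y n - P.y n2, ?_, ?_, ?_⟩
  · rintro ⟨h1, h2⟩
    have h1' : P.x n = P.x n2 := by omega
    have h2' : P.y n = P.y n2 := by omega
    rw [h1', h2'] at hdet
    have : P.x n2 * P.y n2 - P.y n2 * P.x n2 = 0 := by ring
    omega
  · have g1 : P.L i ≤ X + (P.x n - P.x n2) := by omega
    have g2 : X + (P.x n - P.x n2) < P.L i + P.s := by omega
    rw [P.c_eq i _ g1 g2, P.c_eq i X hX1 hX2]
    have hdiff := P.ce_diff i X (X + (P.x n - P.x n2)) (P.y n - P.y n2)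
    have hle : ∑ Z ∈ Finset.Ico (P.L i) (P.L i + P.s),
        (P.E i (Z - X) - P.E i (Z - (X + (P.x n - P.x n2))) - (P.y n - P.y n2))
        ≤ ∑ Z ∈ Finset.Ico (P.L i) (P.L i + P.s), (if Z = X + (P.x n - P.x n2) then 1 else 0) := by
      apply Finset.sum_le_sum
      intro Z hZ
      rw [Finset.mem_Ico] at hZ
      split_ifs with hZ2
      · rw [hZ2, sub_self, E_zero, add_sub_cancel_left]
        by_contra hc
        have h1 : P.y n - P.y n2 + 1 < P.E i (P.x n - P.x n2) := by omega
        rw [lt_E_iff] at h1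
        have hD := P.hD
        have := P.gap_unique i n n2 X (P.L i) (P.x n - P.x n2) (P.y n - P.y n2 + 1) hni hni2 hdet hsum
          hX1 hX2 g1 g2 (by omega) (by omega) (by linarith) h1
        omega
      · by_contra hc
        have h1 : P.E i (Z - X) - 1 < P.E i (Z - X) := by omega
        rw [lt_E_iff] at h1
        have h2 : P.E i (Z - (X + (P.x n - P.x n2))) ≤ P.E i (Z - X) - 1 - (P.y n - P.y n2) := by omega
        rw [E_le_iff] at h2
        have := P.gap_unique i n n2 X (P.L i) (Z - X) (P.E i (Z - X) - 1) hni hni2 hdet hsum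
          hX1 hX2 (by omega) (by omega) (by omega) (by omega) (by linarith) h1
        omega
    rw [Finset.sum_ite_eq' (Finset.Ico (P.L i) (P.L i + P.s)), if_pos (Finset.mem_Ico.2 ⟨g1, g2⟩)] at hle
    omega
  · by_cases c3 : P.L i ≤ X - P.x n
    · have h1 : P.c (X - P.x n) + P.s * P.y n + 1 ≤ P.c X := by
        rw [P.c_eq i X hX1 hX2, P.c_eq i (X - P.x n) c3 (by omega)]
        exact P.strip_lt i _ X _ hX1 hX2 (by rw [sub_sub_cancel]; omega)
      have h2 := (P.window_shift n2 (X - P.x n) (by omega) (by omega)).1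
      rw [show X - (P.x n - P.x n2) = X - P.x n + P.x n2 by ring, mul_sub]
      omega
    by_cases c4 : X + P.x n2 < P.L i + P.s
    · have h1 : P.c (X + P.x n2) + P.s * (-P.y n2) + 1 ≤ P.c X := by
        rw [P.c_eq i X hX1 hX2, P.c_eq i (X + P.x n2) (by omega) c4]
        refine P.strip_lt i _ X _ hX1 hX2 ?_
        rw [sub_add_cancel_left, mul_neg, mul_neg]; omega
      have h2 := (P.window_shift n (X + P.x n2 - P.x n) (by omega) (by omega)).2
      rw [sub_add_cancel] at h2
      rw [show X - (P.x n - P.x n2) = X + P.x n2 - P.x n by ring, mul_sub]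
      rw [mul_neg] at h1
      omega
    have g1 : P.L i ≤ X - (P.x n - P.x n2) := by omega
    have g2 : X - (P.x n - P.x n2) < P.L i + P.s := by omega
    rw [P.c_eq i _ g1 g2, P.c_eq i X hX1 hX2]
    have := P.strip_le i (X - (P.x n - P.x n2)) X (P.y n - P.y n2) (by
      rw [sub_sub_cancel, mul_sub, mul_sub]; omega)
    omega

end GP


namespace GP
variable (P : GP)

lemma L_per (hxp : ∀ n, P.x (n + P.D) = P.x n) (hkp : ∀ n, P.k (n + P.D) = P.k n) (n : ℤ) :
    P.L (n + P.D) = P.L n + (P.L P.D - P.L 0) := by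
  have hstep : ∀ n, P.L (n + 1 + P.D) - P.L (n + 1) = P.L (n + P.D) - P.L n := by
    intro n
    rw [show n + 1 + P.D = (n + P.D) + 1 by ring, P.hL, P.hL, hxp, hkp]; ring
  have : P.L (n + P.D) - P.L n = P.L (0 + P.D) - P.L 0 := by
    induction n using Int.induction_on with
    | zero => rfl
    | succ n ih => rw [hstep, ih]
    | pred n ih =>
      have := hstep (-(n:ℤ) - 1)
      rw [sub_add_cancel] at this
      rw [← this, ih]
  rw [zero_add] at this
  omega

lemma E_per (n u : ℤ) : P.E (n + P.D) u = P.E n u + u := by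
  unfold E
  rw [show (1 - 2 * (n + P.D)) * u = (1 - 2 * n) * u + (2 * P.D) * (-u) by ring,
    Int.add_mul_ediv_left _ _ (by have := P.hD; omega)]
  ring

noncomputable def kap (n : ℤ) : ℤ :=
  P.K n - P.K (n + P.D) - ∑ Z ∈ Finset.Ico (P.L n) (P.L n + P.s), Z

lemma sum_shift (f : ℤ → ℤ) (A s h : ℤ) :
    ∑ Z ∈ Finset.Ico (A + h) (A + h + s), f Z = ∑ Z ∈ Finset.Ico A (A + s), f (Z + h) := by
  refine Finset.sum_nbij' (fun Z => Z - h) (fun Z => Z + h) ?_ ?_ ?_ ?_ ?_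
  · intro Z hZ; simp only [Finset.mem_Ico] at *; omega
  · intro Z hZ; simp only [Finset.mem_Ico] at *; omega
  · intro Z _; simp
  · intro Z _; simp
  · intro Z _; simp

lemma sum_const_strip (A s v : ℤ) (hs : 1 ≤ s) : ∑ _Z ∈ Finset.Ico A (A + s), v = s * v := by
  simp only [Finset.sum_const, Int.card_Ico, nsmul_eq_mul]
  have : (((A + s - A).toNat : ℕ) : ℤ) = s := by
    rw [Int.toNat_of_nonneg (by omega)]; ring
  rw [this]

lemma kap_const (hkp : ∀ n, P.k (n + P.D) = P.k n)
    (hyp : ∀ n, P.y (n + P.D) = P.y n + P.x n) (n : ℤ) : P.kap n = P.kap 0 := by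
  have hstep : ∀ n, P.kap (n + 1) = P.kap n := by
    intro n
    unfold kap
    rw [show n + 1 + P.D = (n + P.D) + 1 by ring, P.hK, P.hK, hyp, hkp, P.hL,
      sum_shift (fun Z => Z), Finset.sum_add_distrib, sum_const_strip _ _ _ P.hs]
    ring
  induction n using Int.induction_on with
  | zero => rfl
  | succ n ih => rw [hstep, ih]
  | pred n ih =>
    have := hstep (-(n:ℤ) - 1)
    rw [sub_add_cancel] at this
    rw [← this, ih]

theorem quasi (hxp : ∀ n, P.x (n + P.D) = P.x n) (hkp : ∀ n, P.k (n + P.D) = P.k n)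
    (hyp : ∀ n, P.y (n + P.D) = P.y n + P.x n) (X : ℤ) :
    P.c (X + (P.L P.D - P.L 0)) = P.c X + P.s * X + P.kap 0 := by
  obtain ⟨n, h1, h2⟩ := P.cover X
  have hL := P.L_per hxp hkp n
  rw [P.c_eq n X h1 h2, P.c_eq (n + P.D) _ (by omega) (by omega), ← P.kap_const hkp hyp n]
  unfold ce kap
  rw [hL, sum_shift]
  have : ∀ Z ∈ Finset.Ico (P.L n) (P.L n + P.s),
      P.E (n + P.D) (Z + (P.L P.D - P.L 0) - (X + (P.L P.D - P.L 0))) = P.E n (Z - X) + (Z - X) := by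
    intro Z _
    rw [add_sub_add_right_eq_sub, E_per]
  rw [Finset.sum_congr rfl this, Finset.sum_add_distrib, Finset.sum_sub_distrib,
    sum_const_strip _ _ _ P.hs]
  ring

end GP

lemma exists_antidiff (a : ℤ → ℤ) : ∃ L : ℤ → ℤ, L 0 = 0 ∧ ∀ n, L (n + 1) = L n + a n := by
  refine ⟨fun n => ∑ i ∈ Finset.range n.toNat, a i - ∑ i ∈ Finset.range (-n).toNat, a (-(i:ℤ) - 1), by simp, ?_⟩
  intro n
  rcases le_or_gt 0 n with h | h
  · obtain ⟨m, rfl⟩ := Int.eq_ofNat_of_zero_le h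
    have e1 : ((m:ℤ) + 1).toNat = m + 1 := by omega
    have e2 : (-((m:ℤ) + 1)).toNat = 0 := by omega
    have e3 : (-(m:ℤ)).toNat = 0 := by omega
    simp only [e1, e2, e3, Finset.sum_range_succ]
    simp
  · obtain ⟨m, hm⟩ := Int.eq_ofNat_of_zero_le (show 0 ≤ -n - 1 by omega)
    obtain rfl : n = -(m:ℤ) - 1 := by omega
    have e1 : (-(m:ℤ) - 1 + 1).toNat = 0 := by omega
    have e2 : (-(-(m:ℤ) - 1 + 1)).toNat = m := by omega
    have e3 : (-(-(m:ℤ) - 1)).toNat = m + 1 := by omega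
    have e4 : (-(m:ℤ) - 1).toNat = 0 := by omega
    simp only [e1, e2, e3, e4, Finset.sum_range_succ]
    simp

lemma Hper_sum (N D : ℕ) (hD : 0 < D) (hdvd : ∀ u, 1 ≤ u → u ≤ N → u ∣ D) :
    Hper N = ∑ n ∈ Finset.Icc 1 D, (N / (D / Nat.gcd D n)) * (D / Nat.gcd D n) := by
  have h0 : ∑ n ∈ Finset.Icc 1 D, (N / (D / Nat.gcd D n)) * (D / Nat.gcd D n)
    = ∑ n ∈ (Finset.Icc 1 D).filter (fun n => D / Nat.gcd D n ≤ N),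
      (N / (D / Nat.gcd D n)) * (D / Nat.gcd D n) := by
    symm
    apply Finset.sum_filter_of_ne
    intro n _ hne
    by_contra h
    push Not at h
    rw [Nat.div_eq_of_lt h] at hne
    simp at hne
  rw [h0]
  unfold Hper
  have key : ∀ x y, 1 ≤ x → x ≤ N → Nat.gcd x y = 1 → Nat.gcd D (y * (D / x)) = D / x := by
    intro x y h1 h2 h3
    obtain ⟨q, rfl⟩ := hdvd x h1 h2
    rw [Nat.mul_div_cancel_left _ h1, Nat.gcd_mul_right, h3, one_mul]
  have key2 : ∀ x, 1 ≤ x → x ≤ N → D / (D / x) = x := by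
    intro x h1 h2
    exact Nat.div_div_self (hdvd x h1 h2) hD.ne'
  refine Finset.sum_nbij' (fun p => p.2 * (D / p.1)) (fun n => (D / Nat.gcd D n, n / Nat.gcd D n)) ?_ ?_ ?_ ?_ ?_
  · rintro ⟨x, y⟩ hp
    simp only [Finset.mem_filter, Finset.mem_product, Finset.mem_Icc] at hp ⊢
    obtain ⟨⟨⟨h1, h2⟩, h3, h4⟩, h5, h6⟩ := hp
    rw [key x y h1 h2 h6, key2 x h1 h2]
    have hq : 0 < D / x := Nat.div_pos (Nat.le_of_dvd hD (hdvd x h1 h2)) h1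
    refine ⟨⟨Nat.mul_pos h3 hq, ?_⟩, h2⟩
    calc y * (D / x) ≤ x * (D / x) := Nat.mul_le_mul_right _ h5
      _ ≤ D := Nat.mul_div_le D x
  · intro n hn
    simp only [Finset.mem_filter, Finset.mem_product, Finset.mem_Icc] at hn ⊢
    obtain ⟨⟨h1, h2⟩, h3⟩ := hn
    have hg : 0 < Nat.gcd D n := Nat.gcd_pos_of_pos_left _ hD
    have a1 : 1 ≤ D / Nat.gcd D n := Nat.div_pos (Nat.gcd_le_left _ hD) hg
    have a2 : 1 ≤ n / Nat.gcd D n := Nat.div_pos (Nat.gcd_le_right _ h1) hg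
    have a3 : n / Nat.gcd D n ≤ D / Nat.gcd D n := Nat.div_le_div_right h2
    exact ⟨⟨⟨a1, h3⟩, a2, a3.trans h3⟩, a3, Nat.coprime_div_gcd_div_gcd hg⟩
  · rintro ⟨x, y⟩ hp
    simp only [Finset.mem_filter, Finset.mem_product, Finset.mem_Icc] at hp
    obtain ⟨⟨⟨h1, h2⟩, h3, h4⟩, h5, h6⟩ := hp
    have hq : 0 < D / x := Nat.div_pos (Nat.le_of_dvd hD (hdvd x h1 h2)) h1
    simp only [key x y h1 h2 h6, key2 x h1 h2, Nat.mul_div_cancel _ hq]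
  · intro n hn
    simp only [Finset.mem_filter, Finset.mem_Icc] at hn
    have hg : 0 < Nat.gcd D n := Nat.gcd_pos_of_pos_left _ hD
    simp only
    rw [Nat.div_div_self (Nat.gcd_dvd_left _ _) hD.ne', Nat.div_mul_cancel (Nat.gcd_dvd_right _ _)]
  · rintro ⟨x, y⟩ hp
    simp only [Finset.mem_filter, Finset.mem_product, Finset.mem_Icc] at hp
    obtain ⟨⟨⟨h1, h2⟩, h3, h4⟩, h5, h6⟩ := hp
    simp only [key x y h1 h2 h6, key2 x h1 h2]

lemma Hper_one : Hper 1 = 1 := by decide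

lemma Hper_lt (t : ℕ) : Hper t < Hper (t + 1) := by
  unfold Hper
  have h1 : ∑ p ∈ (Finset.Icc 1 t ×ˢ Finset.Icc 1 t).filter (fun p => p.2 ≤ p.1 ∧ Nat.gcd p.1 p.2 = 1),
      (t / p.1) * p.1 ≤ ∑ p ∈ (Finset.Icc 1 t ×ˢ Finset.Icc 1 t).filter (fun p => p.2 ≤ p.1 ∧ Nat.gcd p.1 p.2 = 1),
      ((t + 1) / p.1) * p.1 :=
    Finset.sum_le_sum fun p _ => Nat.mul_le_mul_right _ (Nat.div_le_div_right (Nat.le_succ t))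
  refine lt_of_le_of_lt h1 ?_
  refine Finset.sum_lt_sum_of_subset (i := (t + 1, 1)) ?_ ?_ ?_ ?_ ?_
  · intro p hp
    simp only [Finset.mem_filter, Finset.mem_product, Finset.mem_Icc] at hp ⊢
    omega
  · simp
  · simp
  · simp
  · intros; positivity

theorem exists_profile (s N : ℕ) (hs : 1 ≤ s) (hN : 1 ≤ N) (h1 : s - 1 ≤ N) (h2 : N ≤ s) :
    ∃ (P : GP) (κ : ℤ), P.s = s ∧ P.N = N ∧ ∀ X, P.c (X + Hper N) = P.c X + s * X + κ := by
  obtain ⟨D, hDdef⟩ : ∃ D : ℕ, D = Nat.factorial s := ⟨_, rfl⟩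
  have hD : 0 < D := hDdef ▸ Nat.factorial_pos s
  have hdvd : ∀ u, 1 ≤ u → u ≤ s → u ∣ D := fun u h1 h2 => hDdef ▸ Nat.dvd_factorial h1 h2
  let x : ℤ → ℤ := fun n => (D : ℤ) / Int.gcd D n
  let y : ℤ → ℤ := fun n => n / Int.gcd D n
  let k : ℤ → ℤ := fun n => (N : ℤ) / x n
  have hg : ∀ n : ℤ, 0 < (Int.gcd D n : ℤ) := fun n => by
    exact_mod_cast Int.gcd_pos_of_ne_zero_left n (by exact_mod_cast hD.ne')
  have ex : ∀ n, x n * Int.gcd D n = D := fun n => Int.ediv_mul_cancel (Int.gcd_dvd_left _ _)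
  have ey : ∀ n, y n * Int.gcd D n = n := fun n => Int.ediv_mul_cancel (Int.gcd_dvd_right _ _)
  have hDz : (0:ℤ) < D := by exact_mod_cast hD
  have hx : ∀ n, 0 < x n := fun n => by
    have := ex n
    rw [← this] at hDz
    exact pos_of_mul_pos_left hDz (hg n).le
  obtain ⟨L, hL0, hL⟩ := exists_antidiff (fun n => k n * x n)
  obtain ⟨K, hK0, hK⟩ := exists_antidiff (fun n => -((s:ℤ) * (y n * k n)))
  let P : GP :=
    { s := s, N := N, D := D, x := x, y := y, k := k, L := L, K := K
      hs := by omega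
      hN1 := by omega
      hsN := by omega
      hNs := by omega
      hD := hDz
      hdvd := by
        intro u hu1 hu2
        obtain ⟨v, rfl⟩ := Int.eq_ofNat_of_zero_le (show 0 ≤ u by omega)
        exact_mod_cast hdvd v (by omega) (by omega)
      hx := hx
      hxy := by
        intro n
        apply mul_right_cancel₀ (hg n).ne'
        linear_combination (D : ℤ) * ey n - n * ex n
      hcop := by
        intro n
        rw [Int.isCoprime_iff_gcd_eq_one]
        exact Int.gcd_ediv_gcd_ediv_gcd (by exact_mod_cast hg n)
      hk0 := fun n => Int.ediv_nonneg (by omega) (hx n).le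
      hk1 := fun n => Int.ediv_mul_le _ (hx n).ne'
      hk2 := fun n => by
        have := Int.lt_ediv_add_one_mul_self (N:ℤ) (hx n)
        simp only [k]; linarith
      hL := hL
      hK := fun n => by rw [hK n]; ring }
  have hgp : ∀ n : ℤ, Int.gcd D (n + D) = Int.gcd D n := fun n => by simp
  have hxp : ∀ n, x (n + D) = x n := fun n => by simp only [x, hgp]
  have hkp : ∀ n, k (n + D) = k n := fun n => by simp only [k, hxp]
  have hyp : ∀ n, y (n + D) = y n + x n := fun n => by
    simp only [y, x, hgp]
    exact Int.add_ediv_of_dvd_right (Int.gcd_dvd_left _ _)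
  have hH : L D - L 0 = Hper N := by
    have hsum : ∀ m : ℕ, L (m + 1) - L 1 = ∑ n ∈ Finset.Icc 1 m, k n * x n := by
      intro m
      induction m with
      | zero => simp
      | succ m ih =>
        rw [Finset.sum_Icc_succ_top (by omega), ← ih, hL]; push_cast; ring
    have h3 := hsum D
    have h4 : L (D + 1) - L 1 = L D - L 0 := by
      have a1 := hL D
      have a2 := hL 0
      have a3 := hxp 0
      have a4 := hkp 0
      rw [zero_add] at a2 a3 a4
      rw [a1, a2, a3, a4]; ring
    rw [← h4, h3, Hper_sum N D hD (fun u a b => hdvd u a (b.trans h2))]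
    push_cast
    apply Finset.sum_congr rfl
    intro n _
    simp only [k, x, Int.gcd_natCast_natCast]
  refine ⟨P, P.kap 0, rfl, rfl, fun X => ?_⟩
  have := P.quasi hxp hkp hyp X
  change P.c (X + (L D - L 0)) = _ at this
  rw [hH] at this
  exact this


def AS (s : ℤ) (c : ℤ → ℤ) : Prop := ∀ X0 : ℤ, ∃ θ : ℝ, ∀ X j : ℤ, c X - c X0 ≤ s * j →
  ¬ (X = X0 ∧ j = 0) → θ * ((X : ℝ) - X0) < j

def BS (s : ℤ) (c : ℤ → ℤ) : Prop := ∀ X : ℤ, ∃ u w : ℤ, ¬ (u = 0 ∧ w = 0) ∧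
  c (X + u) ≤ c X + s * w + 1 ∧ c (X - u) ≤ c X - s * w + 1

def QS (s : ℤ) (c : ℤ → ℤ) (m : ℤ) : Set (ℝ × ℝ) :=
  {p | ∃ i j : ℤ, p = ((i : ℝ), (j : ℝ)) ∧ m ≤ s * j - c i}

lemma GP.AS_c (P : GP) : AS P.s P.c := by
  intro X0
  obtain ⟨i, hi⟩ := P.Astar X0
  have hD : (0:ℝ) < P.D := by exact_mod_cast P.hD
  refine ⟨(2 * i - 1) / (2 * P.D), fun X j h1 h2 => ?_⟩
  have := hi X j h1 h2
  have h3 : ((2 * i - 1) * (X - X0) : ℝ) < 2 * P.D * j := by exact_mod_cast this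
  rw [div_mul_eq_mul_div, div_lt_iff₀ (by positivity)]
  linarith

lemma GP.BS_c (P : GP) (hN : P.N = P.s - 1) : BS P.s P.c := fun X => P.Bstar hN X

lemma AS.shift {s : ℤ} {c : ℤ → ℤ} (h : AS s c) (i j l : ℤ) :
    AS s (fun X => c (X - i) + s * (j * X) + s * l) := by
  intro X0
  obtain ⟨θ, hθ⟩ := h (X0 - i)
  refine ⟨θ + j, fun X y h1 h2 => ?_⟩
  have h3 := hθ (X - i) (y - j * (X - X0)) (by linarith) (by
    rintro ⟨e1, e2⟩
    have e3 : X = X0 := by omega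
    subst e3
    simp at e2
    exact h2 ⟨rfl, e2⟩)
  push_cast at h3
  linarith

lemma BS.shift {s : ℤ} {c : ℤ → ℤ} (h : BS s c) (i j l : ℤ) :
    BS s (fun X => c (X - i) + s * (j * X) + s * l) := by
  intro X
  obtain ⟨u, w, h0, h1, h2⟩ := h (X - i)
  refine ⟨u, w + j * u, ?_, ?_, ?_⟩
  · rintro ⟨rfl, h3⟩
    simp at h3
    exact h0 ⟨rfl, h3⟩
  · simp only
    rw [show X + u - i = X - i + u by ring]; linarith
  · simp only
    rw [show X - u - i = X - i - u by ring]; linarith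

lemma peel_mono {U V : Set (ℝ × ℝ)} (h : U ⊆ V) : peel U ⊆ peel V := by
  rintro p ⟨hp, hpe⟩
  refine ⟨h hp, fun hext => hpe ?_⟩
  exact inter_extremePoints_subset_extremePoints_of_subset (convexHull_mono h)
    ⟨subset_convexHull ℝ U hp, hext⟩

lemma peel_iter_mono {U V : Set (ℝ × ℝ)} (h : U ⊆ V) (m : ℕ) : peel^[m] U ⊆ peel^[m] V := by
  induction m with
  | zero => exact h
  | succ m ih => rw [Function.iterate_succ_apply', Function.iterate_succ_apply']; exact peel_mono ih

lemma extreme_of_strict (U : Set (ℝ × ℝ)) (p : ℝ × ℝ) (hp : p ∈ U) (θ : ℝ)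
    (h : ∀ q ∈ U, q ≠ p → p.2 - θ * p.1 < q.2 - θ * q.1) :
    p ∈ Set.extremePoints ℝ (convexHull ℝ U) := by
  let C : Set (ℝ × ℝ) := {q | q = p ∨ p.2 - θ * p.1 < q.2 - θ * q.1}
  have hC : Convex ℝ C := by
    rw [convex_iff_forall_pos]
    intro x hx y hy a b ha hb hab
    rcases hx with rfl | hx
    · rcases hy with rfl | hy
      · left; rw [← add_smul, hab, one_smul]
      · right
        simp only [Prod.fst_add, Prod.snd_add, Prod.smul_fst, Prod.smul_snd, smul_eq_mul]
        obtain rfl : a = 1 - b := by linarith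
        nlinarith [mul_pos hb (sub_pos.2 hy)]
    · right
      have hy' : p.2 - θ * p.1 ≤ y.2 - θ * y.1 := by
        rcases hy with rfl | hy
        · exact le_rfl
        · exact hy.le
      simp only [Prod.fst_add, Prod.snd_add, Prod.smul_fst, Prod.smul_snd, smul_eq_mul]
      obtain rfl : a = 1 - b := by linarith
      nlinarith [mul_pos ha (sub_pos.2 hx), mul_nonneg hb.le (sub_nonneg.2 hy')]
  have hsub : convexHull ℝ U ⊆ C := convexHull_min (fun q hq => by
    by_cases hqp : q = p
    · left; exact hqp
    · right; exact h q hq hqp) hC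
  rw [mem_extremePoints]
  refine ⟨subset_convexHull ℝ U hp, fun x hx y hy hseg => ?_⟩
  have hx' := hsub hx
  have hy' := hsub hy
  obtain ⟨a, b, ha, hb, hab, he⟩ := hseg
  have e1 : a * x.1 + b * y.1 = p.1 := by rw [← he]; simp
  have e2 : a * x.2 + b * y.2 = p.2 := by rw [← he]; simp
  have hxle : p.2 - θ * p.1 ≤ x.2 - θ * x.1 := by
    rcases hx' with h | h
    · rw [h]
    · exact h.le
  have hyle : p.2 - θ * p.1 ≤ y.2 - θ * y.1 := by
    rcases hy' with h | h
    · rw [h]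
    · exact h.le
  have hsum : a * ((x.2 - θ * x.1) - (p.2 - θ * p.1)) + b * ((y.2 - θ * y.1) - (p.2 - θ * p.1)) = 0 := by
    obtain rfl : a = 1 - b := by linarith
    linear_combination e2 - θ * e1
  have hx0 := mul_nonneg ha.le (sub_nonneg.2 hxle)
  have hy0 := mul_nonneg hb.le (sub_nonneg.2 hyle)
  constructor
  · rcases hx' with h | h
    · exact h
    · have := mul_pos ha (sub_pos.2 h)
      linarith
  · rcases hy' with h | h
    · exact h
    · have := mul_pos hb (sub_pos.2 h)
      linarith

lemma AS.peel_subset {s : ℤ} {c : ℤ → ℤ} (h : AS s c) (m : ℤ) : peel (QS s c m) ⊆ QS s c (m + 1) := by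
  rintro p ⟨⟨X0, Y0, rfl, hf⟩, hpe⟩
  refine ⟨X0, Y0, rfl, ?_⟩
  by_contra hc
  apply hpe
  obtain ⟨θ, hθ⟩ := h X0
  refine extreme_of_strict _ _ ⟨X0, Y0, rfl, hf⟩ θ ?_
  rintro q ⟨X, Y, rfl, hq⟩ hne
  have h1 := hθ X (Y - Y0) (by rw [mul_sub]; omega) (by
    rintro ⟨e1, e2⟩
    apply hne
    have e3 : Y = Y0 := by omega
    rw [e1, e3])
  push_cast at h1
  simp only
  linarith

lemma not_extreme (U : Set (ℝ × ℝ)) (p v : ℝ × ℝ) (hv : v ≠ 0) (h1 : p + v ∈ U) (h2 : p - v ∈ U) :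
    p ∉ Set.extremePoints ℝ (convexHull ℝ U) := by
  intro h
  rw [mem_extremePoints] at h
  have := (h.2 (p + v) (subset_convexHull ℝ U h1) (p - v) (subset_convexHull ℝ U h2)
    ⟨1/2, 1/2, by norm_num, by norm_num, by norm_num, by
      rw [← smul_add, add_add_sub_cancel, ← two_smul ℝ p, smul_smul]; norm_num⟩).1
  exact hv (by simpa using this)

lemma BS.subset_peel {s : ℤ} {c : ℤ → ℤ} (h : BS s c) (m : ℤ) : QS s c (m + 1) ⊆ peel (QS s c m) := by
  rintro p ⟨X0, Y0, rfl, hf⟩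
  refine ⟨⟨X0, Y0, rfl, by omega⟩, ?_⟩
  obtain ⟨u, w, h0, h1, h2⟩ := h X0
  refine not_extreme _ _ ((u : ℝ), (w : ℝ)) ?_ ?_ ?_
  · intro he
    rw [Prod.mk_eq_zero] at he
    exact h0 ⟨by exact_mod_cast he.1, by exact_mod_cast he.2⟩
  · refine ⟨X0 + u, Y0 + w, by simp, ?_⟩
    rw [mul_add]; omega
  · refine ⟨X0 - u, Y0 - w, by simp, ?_⟩
    rw [mul_sub]; omega

lemma AS.iter {s : ℤ} {c : ℤ → ℤ} (h : AS s c) (m : ℕ) : peel^[m] (QS s c 0) ⊆ QS s c m := by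
  induction m with
  | zero => simp
  | succ m ih =>
    rw [Function.iterate_succ_apply']
    exact (peel_mono ih).trans (by exact_mod_cast h.peel_subset m)

lemma BS.iter {s : ℤ} {c : ℤ → ℤ} (h : BS s c) (m : ℕ) : QS s c m ⊆ peel^[m] (QS s c 0) := by
  induction m with
  | zero => simp
  | succ m ih =>
    rw [Function.iterate_succ_apply']
    exact subset_trans (by exact_mod_cast h.subset_peel m) (peel_mono ih)

lemma periodic_bdd (e : ℤ → ℝ) (H : ℤ) (hH : 0 < H) (h : ∀ X, e (X + H) = e X) :
    ∃ M, ∀ X, |e X| ≤ M := by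
  refine ⟨∑ r ∈ Finset.Ico 0 H, |e r|, fun X => ?_⟩
  have hp : Function.Periodic e H := h
  have h1 : e X = e (X % H) := by
    have := hp.sub_zsmul_eq (X / H) (x := X)
    rw [← this, Int.emod_def]
    congr 1
    simp [mul_comm]
  rw [h1]
  exact Finset.single_le_sum (f := fun r => |e r|) (fun _ _ => abs_nonneg _)
    (Finset.mem_Ico.2 ⟨Int.emod_nonneg _ hH.ne', Int.emod_lt_of_pos _ hH⟩)

lemma profile_dec (s H κ : ℤ) (hs : 0 < s) (hH : 0 < H) (c : ℤ → ℤ)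
    (hc : ∀ X, c (X + H) = c X + s * X + κ) :
    ∃ (β M : ℝ) (e : ℤ → ℝ), (∀ X, |e X| ≤ M) ∧
      ∀ X : ℤ, (c X : ℝ) = s * ((X:ℝ)^2 / (2 * H) + β * X + e X) := by
  have hs' : (s:ℝ) ≠ 0 := by exact_mod_cast hs.ne'
  have hH' : (H:ℝ) ≠ 0 := by exact_mod_cast hH.ne'
  let β : ℝ := (κ / s - H / 2) / H
  let e : ℤ → ℝ := fun X => (c X : ℝ) / s - (X:ℝ)^2 / (2 * H) - β * X
  obtain ⟨M, hM⟩ := periodic_bdd e H hH (fun X => by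
    simp only [e, hc, β]; push_cast; field_simp; ring)
  refine ⟨β, M, e, hM, fun X => ?_⟩
  simp only [e]; field_simp; ring

lemma quad_lb (δ r z : ℝ) (hδ : 0 < δ) (hr0 : 0 ≤ r) (hr : r ≤ 1) :
    0 ≤ δ * z ^ 2 + r * z + 1 / (4 * δ) ∧ 0 ≤ δ * z ^ 2 - r * z + 1 / (4 * δ) := by
  have h1 : δ * (1 / (4 * δ)) = 1 / 4 := by field_simp
  have h2 : r ^ 2 ≤ 1 := by nlinarith
  constructor
  · have : 0 ≤ δ * (δ * z ^ 2 + r * z + 1 / (4 * δ)) := by nlinarith [sq_nonneg (δ * z + r / 2)]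
    exact nonneg_of_mul_nonneg_right this hδ
  · have : 0 ≤ δ * (δ * z ^ 2 - r * z + 1 / (4 * δ)) := by nlinarith [sq_nonneg (δ * z - r / 2)]
    exact nonneg_of_mul_nonneg_right this hδ

lemma place_low (s H κ : ℤ) (hs : 0 < s) (hH : 0 < H) (c : ℤ → ℤ)
    (hc : ∀ X, c (X + H) = c X + s * X + κ) (a b d : ℝ) (ha : 1 / (H:ℝ) < a) :
    ∃ C : ℝ, ∀ x0 : ℤ, ∃ i j l : ℤ,
      (∀ X : ℤ, ((c (X - i) + s * (j * X) + s * l : ℤ) : ℝ) ≤ s * (a * (X:ℝ)^2 / 2 + b * X + d)) ∧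
      s * (a * (x0:ℝ)^2 / 2 + b * x0 + d) ≤ ((c (x0 - i) + s * (j * x0) + s * l : ℤ) : ℝ) + s * C := by
  obtain ⟨β, M, e, hM, hce⟩ := profile_dec s H κ hs hH c hc
  have hs' : (0:ℝ) < s := by exact_mod_cast hs
  have hH' : (0:ℝ) < H := by exact_mod_cast hH
  obtain ⟨δ, hδ⟩ : ∃ δ, δ = (a - 1 / (H:ℝ)) / 2 := ⟨_, rfl⟩
  have hδ0 : 0 < δ := by rw [hδ]; linarith
  refine ⟨2 * M + 1 / (4 * δ) + 1, fun x0 => ?_⟩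
  obtain ⟨j, hj⟩ : ∃ j : ℤ, j = ⌊a * x0 + b - β⌋ := ⟨_, rfl⟩
  obtain ⟨G, hG⟩ : ∃ G : ℝ, G = a * (x0:ℝ)^2 / 2 + b * x0 + d - j * x0 := ⟨_, rfl⟩
  obtain ⟨l, hl⟩ : ∃ l : ℤ, l = ⌊G - M - 1 / (4 * δ)⌋ := ⟨_, rfl⟩
  have hj1 : (j:ℝ) ≤ a * x0 + b - β := hj ▸ Int.floor_le _
  have hj2 : a * x0 + b - β < j + 1 := hj ▸ Int.lt_floor_add_one _
  have hl1 : (l:ℝ) ≤ G - M - 1 / (4 * δ) := hl ▸ Int.floor_le _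
  have hl2 : G - M - 1 / (4 * δ) < l + 1 := hl ▸ Int.lt_floor_add_one _
  refine ⟨x0, j, l, fun X => ?_, ?_⟩
  · push_cast
    rw [hce]
    have hq := (quad_lb δ (a * x0 + b - β - j) ((X:ℝ) - x0) hδ0 (by linarith) (by linarith)).1
    have he := (abs_le.1 (hM (X - x0))).2
    have key : a * (X:ℝ)^2 / 2 + b * X + d = ((X:ℝ) - x0)^2 / (2 * H) + β * (X - x0) + j * X
        + (δ * ((X:ℝ) - x0)^2 + (a * x0 + b - β - j) * ((X:ℝ) - x0) + G) := by
      rw [hδ, hG]; field_simp; ring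
    rw [key]
    push_cast
    have : 0 ≤ s * ((δ * ((X:ℝ) - x0)^2 + (a * x0 + b - β - j) * ((X:ℝ) - x0) + G) - e (X - x0) - l) :=
      mul_nonneg hs'.le (by linarith)
    linarith
  · push_cast
    rw [hce, sub_self]
    have he := (abs_le.1 (hM 0)).1
    have : 0 ≤ (s:ℝ) * (e 0 + l + (2 * M + 1 / (4 * δ) + 1) - G) := mul_nonneg hs'.le (by linarith)
    rw [hG] at this
    push_cast
    rw [show (0:ℝ) ^ 2 / (2 * H) + β * 0 + e 0 = e 0 by simp]
    linarith

lemma place_high (s H κ : ℤ) (hs : 0 < s) (hH : 0 < H) (c : ℤ → ℤ)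
    (hc : ∀ X, c (X + H) = c X + s * X + κ) (a b d : ℝ) (ha : a < 1 / (H:ℝ)) :
    ∃ C : ℝ, ∀ x0 : ℤ, ∃ i j l : ℤ,
      (∀ X : ℤ, s * (a * (X:ℝ)^2 / 2 + b * X + d) ≤ ((c (X - i) + s * (j * X) + s * l : ℤ) : ℝ)) ∧
      ((c (x0 - i) + s * (j * x0) + s * l : ℤ) : ℝ) ≤ s * (a * (x0:ℝ)^2 / 2 + b * x0 + d) + s * C := by
  obtain ⟨β, M, e, hM, hce⟩ := profile_dec s H κ hs hH c hc
  have hs' : (0:ℝ) < s := by exact_mod_cast hs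
  have hH' : (0:ℝ) < H := by exact_mod_cast hH
  obtain ⟨δ, hδ⟩ : ∃ δ, δ = (1 / (H:ℝ) - a) / 2 := ⟨_, rfl⟩
  have hδ0 : 0 < δ := by rw [hδ]; linarith
  refine ⟨2 * M + 1 / (4 * δ) + 1, fun x0 => ?_⟩
  obtain ⟨j, hj⟩ : ∃ j : ℤ, j = ⌊a * x0 + b - β⌋ := ⟨_, rfl⟩
  obtain ⟨G, hG⟩ : ∃ G : ℝ, G = a * (x0:ℝ)^2 / 2 + b * x0 + d - j * x0 := ⟨_, rfl⟩
  obtain ⟨l, hl⟩ : ∃ l : ℤ, l = ⌈G + M + 1 / (4 * δ)⌉ := ⟨_, rfl⟩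
  have hj1 : (j:ℝ) ≤ a * x0 + b - β := hj ▸ Int.floor_le _
  have hj2 : a * x0 + b - β < j + 1 := hj ▸ Int.lt_floor_add_one _
  have hl1 : G + M + 1 / (4 * δ) ≤ l := hl ▸ Int.le_ceil _
  have hl2 : (l:ℝ) < G + M + 1 / (4 * δ) + 1 := hl ▸ Int.ceil_lt_add_one _
  refine ⟨x0, j, l, fun X => ?_, ?_⟩
  · push_cast
    rw [hce]
    have hq := (quad_lb δ (a * x0 + b - β - j) ((X:ℝ) - x0) hδ0 (by linarith) (by linarith)).2
    have he := (abs_le.1 (hM (X - x0))).1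
    have key : a * (X:ℝ)^2 / 2 + b * X + d = ((X:ℝ) - x0)^2 / (2 * H) + β * (X - x0) + j * X
        - (δ * ((X:ℝ) - x0)^2 - (a * x0 + b - β - j) * ((X:ℝ) - x0) - G) := by
      rw [hδ, hG]; field_simp; ring
    rw [key]
    push_cast
    have : 0 ≤ s * ((δ * ((X:ℝ) - x0)^2 - (a * x0 + b - β - j) * ((X:ℝ) - x0) - G) + e (X - x0) + l) :=
      mul_nonneg hs'.le (by linarith)
    linarith
  · push_cast
    rw [hce, sub_self]
    have he := (abs_le.1 (hM 0)).2
    have : 0 ≤ (s:ℝ) * (G + (2 * M + 1 / (4 * δ) + 1) - e 0 - l) := mul_nonneg hs'.le (by linarith)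
    rw [hG] at this
    push_cast
    rw [show (0:ℝ) ^ 2 / (2 * H) + β * 0 + e 0 = e 0 by simp]
    linarith

lemma Hper_pos (t : ℕ) (ht : 1 ≤ t) : 0 < Hper t := by
  obtain ⟨r, rfl⟩ : ∃ r, t = r + 1 := ⟨t - 1, by omega⟩
  exact (Nat.zero_le _).trans_lt (Hper_lt r)

theorem factA (s : ℕ) (hs : 1 ≤ s) (a b d : ℝ) (ha : 1 / (Hper s : ℝ) < a) :
    ∃ C : ℝ, ∀ m : ℕ, peel^[m] (Ugrid fun x => a * x ^ 2 / 2 + b * x + d) ⊆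
      Ugrid fun x => (a * x ^ 2 / 2 + b * x + d) + (m / s - C) := by
  obtain ⟨P, κ, hPs, hPN, hq⟩ := exists_profile s s hs hs (by omega) le_rfl
  have hAS := P.AS_c
  rw [hPs] at hAS
  have hs0 : (0:ℝ) < s := by exact_mod_cast hs
  obtain ⟨C, hC⟩ := place_low s (Hper s) κ (by omega) (by exact_mod_cast Hper_pos s hs) P.c hq a b d
    (by rw [Int.cast_natCast]; exact ha)
  refine ⟨C, fun m => ?_⟩
  intro p hp
  have hsub : ∀ m : ℕ, ∀ U, peel^[m] U ⊆ U := by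
    intro m U
    induction m with
    | zero => simp
    | succ m ih => rw [Function.iterate_succ_apply']; exact fun q hq => ih hq.1
  obtain ⟨⟨x0, y0, rfl⟩, -⟩ := hsub m _ hp
  refine ⟨⟨x0, y0, rfl⟩, ?_⟩
  obtain ⟨i, j, l, h1, h2⟩ := hC x0
  have hT := hAS.shift i j l
  have hU : (Ugrid fun x => a * x ^ 2 / 2 + b * x + d) ⊆
      QS s (fun X => P.c (X - i) + s * (j * X) + s * l) 0 := by
    rintro q ⟨⟨X, Y, rfl⟩, hq⟩
    refine ⟨X, Y, rfl, ?_⟩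
    simp only at hq
    have h3 := (h1 X).trans (mul_le_mul_of_nonneg_left hq (by positivity))
    have h4 : P.c (X - i) + s * (j * X) + s * l ≤ (s:ℤ) * Y := by exact_mod_cast h3
    simp only; omega
  obtain ⟨X, Y, he, hf⟩ := hT.iter m (peel_iter_mono hU m hp)
  obtain ⟨e1, e2⟩ := Prod.mk.inj he
  have e1' : x0 = X := by exact_mod_cast e1
  have e2' : y0 = Y := by exact_mod_cast e2
  subst e1' e2'
  have hf' : (m:ℝ) ≤ s * y0 - ((P.c (x0 - i) + s * (j * x0) + s * l : ℤ) : ℝ) := by exact_mod_cast hf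
  simp only
  have h5 : (s:ℝ) * ((a * (x0:ℝ) ^ 2 / 2 + b * x0 + d) + (m / s - C)) ≤ s * y0 := by
    have : (s:ℝ) * (m / s) = m := by field_simp
    rw [mul_add, mul_sub, this]
    push_cast at h2 hf'
    linarith
  exact le_of_mul_le_mul_left h5 hs0

theorem factB (s : ℕ) (hs : 2 ≤ s) (a b d : ℝ) (ha : a < 1 / (Hper (s - 1) : ℝ)) :
    ∃ C : ℝ, ∀ m : ℕ, (Ugrid fun x => (a * x ^ 2 / 2 + b * x + d) + (m / s + C)) ⊆
      peel^[m] (Ugrid fun x => a * x ^ 2 / 2 + b * x + d) := by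
  obtain ⟨P, κ, hPs, hPN, hq⟩ := exists_profile s (s - 1) (by omega) (by omega) le_rfl (by omega)
  have hBS := P.BS_c (by rw [hPs, hPN]; omega)
  rw [hPs] at hBS
  have hs0 : (0:ℝ) < s := by exact_mod_cast (by omega : 0 < s)
  obtain ⟨C, hC⟩ := place_high s (Hper (s - 1)) κ (by omega)
    (by exact_mod_cast Hper_pos (s - 1) (by omega)) P.c hq a b d (by rw [Int.cast_natCast]; exact ha)
  refine ⟨C, fun m => ?_⟩
  rintro p ⟨⟨x0, y0, rfl⟩, hp⟩
  obtain ⟨i, j, l, h1, h2⟩ := hC x0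
  have hT := hBS.shift i j l
  have hU : QS s (fun X => P.c (X - i) + s * (j * X) + s * l) 0 ⊆
      (Ugrid fun x => a * x ^ 2 / 2 + b * x + d) := by
    rintro q ⟨X, Y, rfl, hq⟩
    refine ⟨⟨X, Y, rfl⟩, ?_⟩
    have h4 : P.c (X - i) + s * (j * X) + s * l ≤ (s:ℤ) * Y := by simp only at hq; omega
    have h3 : ((P.c (X - i) + s * (j * X) + s * l : ℤ) : ℝ) ≤ s * Y := by exact_mod_cast h4
    exact le_of_mul_le_mul_left ((h1 X).trans h3) hs0
  apply peel_iter_mono hU m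
  apply hT.iter m
  refine ⟨x0, y0, rfl, ?_⟩
  simp only at hp
  have h5 := mul_le_mul_of_nonneg_left hp hs0.le
  have : (s:ℝ) * (m / s) = m := by field_simp
  rw [mul_add (s:ℝ) (_ + d), mul_add (s:ℝ) (_ / _), this] at h5
  have h6 : (m:ℝ) ≤ s * y0 - ((P.c (x0 - i) + s * (j * x0) + s * l : ℤ) : ℝ) := by
    push_cast at h2 ⊢
    linarith
  exact_mod_cast h6


lemma trivial_step (g : ℝ → ℝ) (m : ℕ) : Ugrid (fun x => g x + m) ⊆ peel^[m] (Ugrid g) := by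
  induction m with
  | zero => simp
  | succ m ih =>
    rw [Function.iterate_succ_apply']
    refine subset_trans ?_ (peel_mono ih)
    rintro p ⟨⟨i, j, rfl⟩, hp⟩
    simp only [Nat.cast_add, Nat.cast_one] at hp
    refine ⟨⟨⟨i, j, rfl⟩, by simp only; linarith⟩, ?_⟩
    refine not_extreme _ _ ((0 : ℝ), (1 : ℝ)) (by simp) ?_ ?_
    · refine ⟨⟨i, j + 1, by simp⟩, ?_⟩
      simp only [Prod.mk_add_mk, add_zero]; linarith
    · refine ⟨⟨i, j - 1, by simp⟩, ?_⟩
      simp only [Prod.mk_sub_mk, sub_zero]; linarith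

lemma peel_iter_subset (m : ℕ) (U : Set (ℝ × ℝ)) : peel^[m] U ⊆ U := by
  induction m with
  | zero => simp
  | succ m ih => rw [Function.iterate_succ_apply']; exact fun q hq => ih hq.1

lemma gamma_le (g : ℝ → ℝ) (m : ℕ) (γ γ' : ℝ) (h : peel^[m] (Ugrid g) ⊆ Ugrid (fun x => g x + γ))
    (h' : Ugrid (fun x => g x + γ') ⊆ peel^[m] (Ugrid g)) : γ ≤ γ' + 1 := by
  have h1 : ((0:ℝ), ((⌈g 0 + γ'⌉ : ℤ) : ℝ)) ∈ Ugrid (fun x => g x + γ') :=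
    ⟨⟨0, ⌈g 0 + γ'⌉, by simp⟩, Int.le_ceil _⟩
  have h2 := (h (h' h1)).2
  simp only at h2
  have := Int.ceil_lt_add_one (g 0 + γ')
  linarith

def SS (g : ℝ → ℝ) (m : ℕ) : Set ℝ := {γ : ℝ | peel^[m] (Ugrid g) ⊆ Ugrid (fun x => g x + γ)}
def II (g : ℝ → ℝ) (m : ℕ) : Set ℝ := {γ : ℝ | Ugrid (fun x => g x + γ) ⊆ peel^[m] (Ugrid g)}

lemma zero_mem_SS (g : ℝ → ℝ) (m : ℕ) : (0:ℝ) ∈ SS g m := by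
  simp only [SS, Set.mem_ofPred_eq, add_zero]; exact peel_iter_subset m _

lemma m_mem_II (g : ℝ → ℝ) (m : ℕ) : (m:ℝ) ∈ II g m := trivial_step g m

lemma SS_bdd (g : ℝ → ℝ) (m : ℕ) : BddAbove (SS g m) :=
  ⟨m + 1, fun γ hγ => gamma_le g m γ m hγ (m_mem_II g m)⟩

lemma II_bdd (g : ℝ → ℝ) (m : ℕ) : BddBelow (II g m) :=
  ⟨-1, fun γ hγ => by have := gamma_le g m 0 γ (zero_mem_SS g m) hγ; linarith⟩

lemma SS_le_II (g : ℝ → ℝ) (m : ℕ) : sSup (SS g m) ≤ sInf (II g m) + 1 := by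
  apply csSup_le ⟨0, zero_mem_SS g m⟩
  intro γ hγ
  rw [← sub_le_iff_le_add]
  apply le_csInf ⟨(m:ℝ), m_mem_II g m⟩
  intro γ' hγ'
  have := gamma_le g m γ γ' hγ hγ'
  linarith

section Lim
open Filter Topology

lemma div_m_tendsto (C : ℝ) : Tendsto (fun m : ℕ => C / (m:ℝ)) atTop (𝓝 0) :=
  tendsto_const_div_atTop_nhds_zero_nat C

lemma u_nonneg (g : ℝ → ℝ) (m : ℕ) : 0 ≤ sSup (SS g m) / m :=
  div_nonneg (le_csSup (SS_bdd g m) (zero_mem_SS g m)) (Nat.cast_nonneg m)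

lemma u_le (g : ℝ → ℝ) (m : ℕ) : sSup (SS g m) / m ≤ 2 := by
  have h : sSup (SS g m) ≤ m + 1 :=
    csSup_le ⟨0, zero_mem_SS g m⟩ fun γ hγ => gamma_le g m γ m hγ (m_mem_II g m)
  rcases Nat.eq_zero_or_pos m with rfl | hm
  · simp
  · have : (1:ℝ) ≤ m := by exact_mod_cast hm
    rw [div_le_iff₀ (by linarith)]; linarith

lemma w_le (g : ℝ → ℝ) (m : ℕ) : sInf (II g m) / m ≤ 1 := by
  have h : sInf (II g m) ≤ m := csInf_le (II_bdd g m) (m_mem_II g m)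
  exact div_le_one_of_le₀ h (Nat.cast_nonneg m)

lemma w_ge (g : ℝ → ℝ) (m : ℕ) : -1 ≤ sInf (II g m) / m := by
  have h : -1 ≤ sInf (II g m) := le_csInf ⟨m, m_mem_II g m⟩ fun γ hγ => by
    have := gamma_le g m 0 γ (zero_mem_SS g m) hγ; linarith
  rcases Nat.eq_zero_or_pos m with rfl | hm
  · simp
  · have : (1:ℝ) ≤ m := by exact_mod_cast hm
    rw [le_div_iff₀ (by linarith)]; linarith

lemma vLower_eq (g : ℝ → ℝ) : vLower g = liminf (fun m : ℕ => sSup (SS g m) / m) atTop := rfl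
lemma vUpper_eq (g : ℝ → ℝ) : vUpper g = limsup (fun m : ℕ => sInf (II g m) / m) atTop := rfl

lemma vLower_ge (g : ℝ → ℝ) (s : ℕ) (C : ℝ)
    (h : ∀ m : ℕ, (m / s - C : ℝ) ∈ SS g m) : 1 / (s:ℝ) ≤ vLower g := by
  rw [vLower_eq]
  have ht : Tendsto (fun m : ℕ => 1 / (s:ℝ) - C / (m:ℝ)) atTop (𝓝 (1 / (s:ℝ))) := by
    simpa using tendsto_const_nhds.sub (div_m_tendsto C)
  rw [← ht.liminf_eq]
  refine liminf_le_liminf ?_ ht.isBoundedUnder_ge ?_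
  · filter_upwards [eventually_ge_atTop 1] with m hm
    have hm' : (0:ℝ) < m := by exact_mod_cast hm
    have := le_csSup (SS_bdd g m) (h m)
    rw [le_div_iff₀ hm', sub_mul, div_mul_cancel₀ _ hm'.ne']
    calc _ = (m / s - C : ℝ) := by ring
      _ ≤ _ := this
  · exact (isBoundedUnder_of ⟨2, fun m => u_le g m⟩ : IsBoundedUnder (· ≤ ·) atTop _).isCoboundedUnder_ge

lemma vUpper_le (g : ℝ → ℝ) (s : ℕ) (C : ℝ)
    (h : ∀ m : ℕ, (m / s + C : ℝ) ∈ II g m) : vUpper g ≤ 1 / (s:ℝ) := by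
  rw [vUpper_eq]
  have ht : Tendsto (fun m : ℕ => 1 / (s:ℝ) + C / (m:ℝ)) atTop (𝓝 (1 / (s:ℝ))) := by
    simpa using tendsto_const_nhds.add (div_m_tendsto C)
  rw [← ht.limsup_eq]
  refine limsup_le_limsup ?_ ?_ ht.isBoundedUnder_le
  · filter_upwards [eventually_ge_atTop 1] with m hm
    have hm' : (0:ℝ) < m := by exact_mod_cast hm
    have := csInf_le (II_bdd g m) (h m)
    rw [div_le_iff₀ hm', add_mul, div_mul_cancel₀ _ hm'.ne']
    calc _ ≤ (m / s + C : ℝ) := this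
      _ = _ := by ring
  · exact (isBoundedUnder_of ⟨-1, fun m => w_ge g m⟩ : IsBoundedUnder (· ≥ ·) atTop _).isCoboundedUnder_le

lemma vLower_le_vUpper (g : ℝ → ℝ) : vLower g ≤ vUpper g := by
  by_contra hlt
  push Not at hlt
  rw [vLower_eq, vUpper_eq] at hlt
  obtain ⟨c1, h1, h2⟩ := exists_between hlt
  obtain ⟨c2, h3, h4⟩ := exists_between h2
  have e1 := eventually_lt_of_lt_liminf h4
    (isBoundedUnder_of ⟨0, fun m => u_nonneg g m⟩ : IsBoundedUnder (· ≥ ·) atTop _)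
  have e2 := eventually_lt_of_limsup_lt h1
    (isBoundedUnder_of ⟨1, fun m => w_le g m⟩ : IsBoundedUnder (· ≤ ·) atTop _)
  have e3 := (div_m_tendsto 1).eventually (gt_mem_nhds (sub_pos.2 h3))
  obtain ⟨m, a1, a2, a3⟩ := (e1.and (e2.and e3)).exists
  have := div_le_div_of_nonneg_right (SS_le_II g m) (Nat.cast_nonneg m : (0:ℝ) ≤ m)
  rw [add_div] at this
  linarith

end Lim

/-- Average speed of grid peeling for the parabola y = a·x²/2 + b·x + c,
depending on the position of the coefficient a relative to the critical
values 1/H_t. -/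
theorem averageSpeed_parabola (a b c : ℝ) (ha : 0 < a) (t : ℕ) (ht : 2 ≤ t)
    (g : ℝ → ℝ) (hg : g = fun x => a * x ^ 2 / 2 + b * x + c) :
    (1 / (Hper t : ℝ) < a → a < 1 / (Hper (t - 1) : ℝ) → Odd t →
      vLower g = 1 / (t : ℝ) ∧ vUpper g = 1 / (t : ℝ)) ∧
    (1 < a → vLower g = 1 ∧ vUpper g = 1) ∧
    (1 / (Hper t : ℝ) < a → a < 1 / (Hper (t - 1) : ℝ) → Even t →
      1 / ((t : ℝ) + 1) ≤ vLower g ∧ vLower g ≤ vUpper g ∧ vUpper g ≤ 1 / ((t : ℝ) - 1)) ∧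
    (a = 1 / (Hper t : ℝ) → Odd t →
      1 / ((t : ℝ) + 2) ≤ vLower g ∧ vLower g ≤ vUpper g ∧ vUpper g ≤ 1 / (t : ℝ)) ∧
    (a = 1 / (Hper t : ℝ) → Even t →
      1 / ((t : ℝ) + 1) ≤ vLower g ∧ vLower g ≤ vUpper g ∧ vUpper g ≤ 1 / ((t : ℝ) - 1)) := by
  subst hg
  have FA : ∀ s : ℕ, 1 ≤ s → 1 / (Hper s : ℝ) < a →
      1 / (s:ℝ) ≤ vLower (fun x => a * x ^ 2 / 2 + b * x + c) := by
    intro s hs h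
    obtain ⟨C, hC⟩ := factA s hs a b c h
    exact vLower_ge _ s C hC
  have FB : ∀ s : ℕ, 2 ≤ s → a < 1 / (Hper (s - 1) : ℝ) →
      vUpper (fun x => a * x ^ 2 / 2 + b * x + c) ≤ 1 / (s:ℝ) := by
    intro s hs h
    obtain ⟨C, hC⟩ := factB s hs a b c h
    exact vUpper_le _ s C hC
  have hLU := vLower_le_vUpper (fun x => a * x ^ 2 / 2 + b * x + c)
  have ht' : (2:ℝ) ≤ t := by exact_mod_cast ht
  have i1 : 1 / ((t:ℝ) + 1) ≤ 1 / (t:ℝ) := one_div_le_one_div_of_le (by linarith) (by linarith)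
  have i2 : 1 / (t:ℝ) ≤ 1 / ((t:ℝ) - 1) := one_div_le_one_div_of_le (by linarith) (by linarith)
  have i3 : 1 / ((t:ℝ) + 2) ≤ 1 / ((t:ℝ) + 1) := one_div_le_one_div_of_le (by linarith) (by linarith)
  have crit : a = 1 / (Hper t : ℝ) →
      1 / ((t:ℝ) + 1) ≤ vLower (fun x => a * x ^ 2 / 2 + b * x + c) ∧
      vUpper (fun x => a * x ^ 2 / 2 + b * x + c) ≤ 1 / (t:ℝ) := by
    intro h
    have p1 : (0:ℝ) < Hper t := by exact_mod_cast Hper_pos t (by omega)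
    have p0 : (0:ℝ) < Hper (t - 1) := by exact_mod_cast Hper_pos (t - 1) (by omega)
    have l1 : (Hper t : ℝ) < Hper (t + 1) := by exact_mod_cast Hper_lt t
    have l0 : (Hper (t - 1) : ℝ) < Hper t := by
      have := Hper_lt (t - 1)
      rw [Nat.sub_add_cancel (by omega)] at this
      exact_mod_cast this
    constructor
    · have := FA (t + 1) (by omega) (by rw [h]; exact one_div_lt_one_div_of_lt p1 l1)
      push_cast at this
      exact this
    · exact FB t ht (by rw [h]; exact one_div_lt_one_div_of_lt p0 l0)
  refine ⟨fun h1 h2 _ => ?_, fun h => ?_, fun h1 h2 _ => ?_, fun h _ => ?_, fun h _ => ?_⟩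
  · have k1 := FA t (by omega) h1
    have k2 := FB t ht h2
    exact ⟨le_antisymm (hLU.trans k2) k1, le_antisymm k2 (k1.trans hLU)⟩
  · have k1 := FA 1 le_rfl (by rw [Hper_one]; simpa using h)
    have k2 := vUpper_le (fun x => a * x ^ 2 / 2 + b * x + c) 1 0 (fun m => by
      simpa using m_mem_II (fun x => a * x ^ 2 / 2 + b * x + c) m)
    simp only [Nat.cast_one, div_one] at k1 k2
    exact ⟨le_antisymm (hLU.trans k2) k1, le_antisymm k2 (k1.trans hLU)⟩
  · exact ⟨i1.trans (FA t (by omega) h1), hLU, (FB t ht h2).trans i2⟩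
  · obtain ⟨k1, k2⟩ := crit h
    exact ⟨i3.trans k1, hLU, k2⟩
  · obtain ⟨k1, k2⟩ := crit h
    exact ⟨k1, hLU, k2.trans i2⟩
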